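/- arXiv:1509.04794 — 10 statements merged into one kernel-verified Lean document; each statement's English description precedes it below -/
import Mathlib

section
/- Let g(s) = a₀ + Σ_{j=1}^k a_j s^{α_j} with k ≥ 1, coefficients a₀, a₁, …, a_k > 0 and real exponents 0 < α₁ < … < α_k, and set a = α_k/(α_k+1), G(s) = s·g(s), K(ξ) = 1/g(G⁻¹(ξ)). Then K is differentiable on (0,∞) and for every ξ > 0 one has 0 ≥ K'(ξ) ≥ −a·K(ξ)/ξ. -/
open Set

/-- A generalized polynomial with nonnegative coefficients and exponents in `[0, b]` has at every
`s > 0` a nonnegative derivative, at most `b / s` times its value (an Euler inequality). -/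
theorem exists_hasDerivAt_generalizedPolynomial {ι : Type*} (I : Finset ι) (c β : ι → ℝ)
    {c₀ b s : ℝ} (hc₀ : 0 ≤ c₀) (hb : 0 ≤ b) (hc : ∀ j ∈ I, 0 ≤ c j)
    (hβ : ∀ j ∈ I, 0 ≤ β j ∧ β j ≤ b) (hs : 0 < s) :
    ∃ d, HasDerivAt (fun x : ℝ => c₀ + ∑ j ∈ I, c j * x ^ β j) d s ∧ 0 ≤ d ∧
      s * d ≤ b * (c₀ + ∑ j ∈ I, c j * s ^ β j) := by
  refine ⟨∑ j ∈ I, c j * (β j * s ^ (β j - 1)), ?_, ?_, ?_⟩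
  · exact (HasDerivAt.fun_sum fun j _ =>
      (Real.hasDerivAt_rpow_const (Or.inl hs.ne')).const_mul (c j)).const_add c₀
  · exact Finset.sum_nonneg fun j hj =>
      mul_nonneg (hc j hj) (mul_nonneg (hβ j hj).1 (Real.rpow_nonneg hs.le _))
  · have hsum : s * ∑ j ∈ I, c j * (β j * s ^ (β j - 1)) ≤ b * ∑ j ∈ I, c j * s ^ β j := by
      rw [Finset.mul_sum, Finset.mul_sum]
      refine Finset.sum_le_sum fun j hj => ?_
      have hpow : s * s ^ (β j - 1) = s ^ β j := by
        rw [Real.rpow_sub_one hs.ne']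
        field_simp
      calc s * (c j * (β j * s ^ (β j - 1))) = β j * (c j * s ^ β j) := by
            rw [← hpow]; ring
        _ ≤ b * (c j * s ^ β j) :=
            mul_le_mul_of_nonneg_right (hβ j hj).2
              (mul_nonneg (hc j hj) (Real.rpow_nonneg hs.le _))
    nlinarith [mul_nonneg hb hc₀]

/-- A right inverse on `[0, ∞)` of a monotone function, which is also a left inverse there, is
continuous on `(0, ∞)`. -/
theorem continuousAt_inverse_of_monotoneOn {G H : ℝ → ℝ} (hG : MonotoneOn G (Ici 0))
    (hG₀ : ∀ s, 0 < s → 0 < G s) (hHG : ∀ s, 0 ≤ s → H (G s) = s)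
    (hGH : ∀ ξ, 0 ≤ ξ → 0 ≤ H ξ ∧ G (H ξ) = ξ) {ξ : ℝ} (hξ : 0 < ξ) (hHξ : 0 < H ξ) :
    ContinuousAt H ξ := by
  have hmono : StrictMonoOn H (Ioi 0) := by
    intro x hx y hy hxy
    by_contra! hle
    have hx' := hGH x (le_of_lt hx)
    have hy' := hGH y (le_of_lt hy)
    have := hG hy'.1 hx'.1 hle
    rw [hx'.2, hy'.2] at this
    exact absurd hxy this.not_gt
  refine hmono.continuousAt_of_image_mem_nhds (Ioi_mem_nhds hξ) ?_
  exact Filter.mem_of_superset (Ioi_mem_nhds hHξ) fun s hs => ⟨G s, hG₀ s hs, hHG s (le_of_lt hs)⟩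

/-- With `a = α_k/(α_k+1)`, `G(s) = s·g(s)`, `K(ξ) = 1/g(G⁻¹(ξ))`,
the function `K` is differentiable on `(0,∞)` and `0 ≥ K'(ξ) ≥ -a·K(ξ)/ξ`
for every `ξ > 0`. -/
theorem stmt_1
    (k : ℕ) (hk : 1 ≤ k) (a α : ℕ → ℝ)
    (ha : ∀ j ≤ k, 0 < a j)
    (hα1 : 0 < α 1)
    (hαmono : ∀ i j : ℕ, 1 ≤ i → i < j → j ≤ k → α i < α j)
    (g G Ginv K : ℝ → ℝ)
    (hg : ∀ s : ℝ, g s = a 0 + ∑ j ∈ Finset.Icc 1 k, a j * s ^ (α j))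
    (hG : ∀ s : ℝ, G s = s * g s)
    (hGinv1 : ∀ s : ℝ, 0 ≤ s → Ginv (G s) = s)
    (hGinv2 : ∀ ξ : ℝ, 0 ≤ ξ → 0 ≤ Ginv ξ ∧ G (Ginv ξ) = ξ)
    (hK : ∀ ξ : ℝ, K ξ = 1 / g (Ginv ξ))
    (aa : ℝ) (haa : aa = α k / (α k + 1)) :
    (∀ ξ : ℝ, 0 < ξ → DifferentiableAt ℝ K ξ) ∧
    (∀ ξ : ℝ, 0 < ξ → deriv K ξ ≤ 0 ∧ -(aa * K ξ / ξ) ≤ deriv K ξ) := by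
  have hαpos : ∀ j ∈ Finset.Icc 1 k, 0 ≤ α j ∧ α j ≤ α k := by
    intro j hj
    obtain ⟨h1, h2⟩ := Finset.mem_Icc.mp hj
    constructor
    · rcases h1.eq_or_lt with rfl | h
      · exact hα1.le
      · exact (hα1.trans (hαmono 1 j le_rfl h h2)).le
    · rcases h2.eq_or_lt with rfl | h
      · exact le_rfl
      · exact (hαmono j k h1 h le_rfl).le
  have hαk : 0 ≤ α k := (hαpos k (Finset.mem_Icc.mpr ⟨hk, le_rfl⟩)).1
  have hac : ∀ j ∈ Finset.Icc 1 k, 0 ≤ a j := fun j hj => (ha j (Finset.mem_Icc.mp hj).2).le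
  have ha0 : 0 < a 0 := ha 0 (Nat.zero_le k)
  have hgpos : ∀ s, 0 ≤ s → 0 < g s := by
    intro s hs
    rw [hg]
    exact add_pos_of_pos_of_nonneg ha0
      (Finset.sum_nonneg fun j hj => mul_nonneg (hac j hj) (Real.rpow_nonneg hs _))
  have hgmono : MonotoneOn g (Ici 0) := by
    intro x hx y _ hxy
    rw [hg, hg]
    gcongr with j hj
    · exact hac j hj
    · exact (hαpos j hj).1
  have hGmono : MonotoneOn G (Ici 0) := by
    intro x hx y hy hxy
    rw [hG, hG]
    exact mul_le_mul hxy (hgmono hx hy hxy) (hgpos x hx).le hy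
  have hGpos : ∀ s, 0 < s → 0 < G s := fun s hs => by
    rw [hG]
    exact mul_pos hs (hgpos s hs.le)
  have key : ∀ ξ : ℝ, 0 < ξ → ∃ D, HasDerivAt K D ξ ∧ D ≤ 0 ∧ -(aa * K ξ / ξ) ≤ D := by
    intro ξ hξ
    obtain ⟨hs0, hGs⟩ := hGinv2 ξ hξ.le
    have hs : 0 < Ginv ξ := by
      refine hs0.lt_of_ne fun h => ?_
      rw [← h, hG, zero_mul] at hGs
      exact hξ.ne hGs
    have hcont : ContinuousAt Ginv ξ :=
      continuousAt_inverse_of_monotoneOn hGmono hGpos hGinv1 hGinv2 hξ hs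
    obtain ⟨d, hd, hd0, hdle⟩ := exists_hasDerivAt_generalizedPolynomial (Finset.Icc 1 k) a α
      ha0.le hαk hac hαpos hs
    rw [← funext hg] at hd
    rw [← hg] at hdle
    have hgs : 0 < g (Ginv ξ) := hgpos _ hs0
    have hGd : HasDerivAt G (g (Ginv ξ) + Ginv ξ * d) (Ginv ξ) := by
      rw [funext hG]
      simpa using (hasDerivAt_id' (Ginv ξ)).fun_mul hd
    have hden : 0 < g (Ginv ξ) + Ginv ξ * d := by positivity
    have hinv : HasDerivAt Ginv (g (Ginv ξ) + Ginv ξ * d)⁻¹ ξ := by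
      refine hGd.of_local_left_inverse hcont hden.ne' ?_
      filter_upwards [Ioi_mem_nhds hξ] with y hy using (hGinv2 y (le_of_lt hy)).2
    have hKd : HasDerivAt K
        (-(d * (g (Ginv ξ) + Ginv ξ * d)⁻¹) / g (Ginv ξ) ^ 2) ξ := by
      rw [show K = fun x => (g (Ginv x))⁻¹ from funext fun x => by rw [hK, one_div]]
      exact (hd.comp ξ hinv).fun_inv hgs.ne'
    refine ⟨_, hKd, ?_, ?_⟩
    · rw [neg_div]
      exact neg_nonpos.mpr (by positivity)
    · have hξ' : ξ = Ginv ξ * g (Ginv ξ) := by rw [← hG, hGs]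
      have hbound : d * (g (Ginv ξ) + Ginv ξ * d)⁻¹ ≤ aa / Ginv ξ := by
        rw [haa, ← div_eq_mul_inv, div_div, div_le_div_iff₀ hden (by positivity)]
        nlinarith
      have hrw : aa * K ξ / ξ = aa / Ginv ξ / g (Ginv ξ) ^ 2 := by
        rw [hK]
        nth_rewrite 2 [hξ']
        field_simp
      rw [hrw, neg_div, neg_le_neg_iff]
      gcongr
  refine ⟨fun ξ hξ => ?_, fun ξ hξ => ?_⟩
  · obtain ⟨D, hD, -⟩ := key ξ hξ
    exact hD.differentiableAt
  · obtain ⟨D, hD, h⟩ := key ξ hξ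
    rwa [hD.deriv]
end

section
/- Let g(s) = a₀ + Σ_{j=1}^k a_j s^{α_j} with k ≥ 1, coefficients a₀, a₁, …, a_k > 0 and real exponents 0 < α₁ < … < α_k, and set a = α_k/(α_k+1), G(s) = s·g(s), K(ξ) = 1/g(G⁻¹(ξ)). Then there exist constants C₀, C₁ > 0 (depending only on g) such that for all ξ ≥ 0: C₀(1+ξ)^{−a} ≤ K(ξ) ≤ C₁(1+ξ)^{−a} ≤ C₁. -/
open Set

/-- A shifted power is controlled by the sum of the powers, for every positive exponent. -/
lemma one_add_rpow_le_two_rpow_mul {p s : ℝ} (hp : 0 < p) (hs : 0 ≤ s) :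
    (1 + s) ^ p ≤ 2 ^ p * (1 + s ^ p) := by
  have h2 : (0 : ℝ) ≤ 2 ^ p := by positivity
  have hsp : 0 ≤ s ^ p := by positivity
  rcases le_total s 1 with h | h
  · have h1 : (1 + s) ^ p ≤ 2 ^ p := Real.rpow_le_rpow (by linarith) (by linarith) hp.le
    nlinarith
  · have h1 : (1 + s) ^ p ≤ (2 * s) ^ p := Real.rpow_le_rpow (by linarith) (by linarith) hp.le
    rw [Real.mul_rpow zero_le_two hs] at h1
    nlinarith

/-- If `g` grows like `(1 + s) ^ b` and `1 + s * g` like `(1 + s) ^ (b + 1)`, then `g` is comparable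
to `(1 + s * g) ^ (b / (b + 1))`. -/
lemma comparable_rpow_div {b c C d D : ℝ} (hb : 0 < b) (hc : 0 < c) (hC : 0 < C) (hd : 0 < d)
    (hD : 0 < D) {s y ξ : ℝ} (hs : 0 ≤ s) (hξ : 0 ≤ ξ)
    (hcy : c * (1 + s) ^ b ≤ y) (hyC : y ≤ C * (1 + s) ^ b)
    (hdξ : d * (1 + s) ^ (b + 1) ≤ 1 + ξ) (hξD : 1 + ξ ≤ D * (1 + s) ^ (b + 1)) :
    c / D ^ (b / (b + 1)) * (1 + ξ) ^ (b / (b + 1)) ≤ y ∧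
      y ≤ C / d ^ (b / (b + 1)) * (1 + ξ) ^ (b / (b + 1)) := by
  have hq : 0 ≤ b / (b + 1) := by positivity
  have hpow : ((1 + s) ^ (b + 1)) ^ (b / (b + 1)) = (1 + s) ^ b := by
    rw [← Real.rpow_mul (by linarith), mul_div_cancel₀ b (by positivity)]
  have h1 := Real.rpow_le_rpow (by positivity) hdξ hq
  have h2 := Real.rpow_le_rpow (by positivity) hξD hq
  rw [Real.mul_rpow (by positivity) (by positivity), hpow] at h1 h2
  constructor
  · refine le_trans ?_ hcy
    rw [div_mul_eq_mul_div, div_le_iff₀ (by positivity)]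
    nlinarith
  · refine hyC.trans ?_
    rw [div_mul_eq_mul_div, le_div_iff₀ (by positivity)]
    nlinarith

/-- With `a = α_k/(α_k+1)`, `G(s) = s·g(s)`, `K(ξ) = 1/g(G⁻¹(ξ))`,
there exist constants `C₀, C₁ > 0` such that
`C₀(1+ξ)^{-a} ≤ K(ξ) ≤ C₁(1+ξ)^{-a} ≤ C₁` for all `ξ ≥ 0`. -/
theorem stmt_2
    (k : ℕ) (hk : 1 ≤ k) (a α : ℕ → ℝ)
    (ha : ∀ j ≤ k, 0 < a j)
    (hα1 : 0 < α 1)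
    (hαmono : ∀ i j : ℕ, 1 ≤ i → i < j → j ≤ k → α i < α j)
    (g G Ginv K : ℝ → ℝ)
    (hg : ∀ s : ℝ, g s = a 0 + ∑ j ∈ Finset.Icc 1 k, a j * s ^ (α j))
    (hG : ∀ s : ℝ, G s = s * g s)
    (hGinv1 : ∀ s : ℝ, 0 ≤ s → Ginv (G s) = s)
    (hGinv2 : ∀ ξ : ℝ, 0 ≤ ξ → 0 ≤ Ginv ξ ∧ G (Ginv ξ) = ξ)
    (hK : ∀ ξ : ℝ, K ξ = 1 / g (Ginv ξ))
    (aa : ℝ) (haa : aa = α k / (α k + 1)) :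
    ∃ C₀ C₁ : ℝ, 0 < C₀ ∧ 0 < C₁ ∧ ∀ ξ : ℝ, 0 ≤ ξ →
      C₀ * (1 + ξ) ^ (-aa) ≤ K ξ ∧ K ξ ≤ C₁ * (1 + ξ) ^ (-aa) ∧
      C₁ * (1 + ξ) ^ (-aa) ≤ C₁ := by
  have hαle : ∀ j ∈ Finset.Icc 1 k, α j ≤ α k := by
    intro j hj
    obtain ⟨h1, h2⟩ := Finset.mem_Icc.mp hj
    rcases h2.eq_or_lt with rfl | h
    · exact le_rfl
    · exact (hαmono j k h1 h le_rfl).le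
  have hb : 0 < α k := hα1.trans_le (hαle 1 (Finset.mem_Icc.mpr ⟨le_rfl, hk⟩))
  have hαpos : ∀ j ∈ Finset.Icc 1 k, 0 ≤ α j := by
    intro j hj
    obtain ⟨h1, h2⟩ := Finset.mem_Icc.mp hj
    rcases h1.eq_or_lt with rfl | h
    · exact hα1.le
    · exact (hα1.trans (hαmono 1 j le_rfl h h2)).le
  have ha0 : 0 < a 0 := ha 0 (Nat.zero_le k)
  have hak : 0 < a k := ha k le_rfl
  have haj : ∀ j ∈ Finset.Icc 1 k, 0 < a j := fun j hj => ha j (Finset.mem_Icc.mp hj).2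
  set b := α k
  set C : ℝ := a 0 + ∑ j ∈ Finset.Icc 1 k, a j with hCdef
  have hC : 0 < C := by
    have : 0 ≤ ∑ j ∈ Finset.Icc 1 k, a j := Finset.sum_nonneg fun j hj => (haj j hj).le
    linarith
  have hlow : ∀ s : ℝ, 0 ≤ s → a 0 + a k * s ^ b ≤ g s := by
    intro s hs
    rw [hg]
    have := Finset.single_le_sum (f := fun j => a j * s ^ α j)
      (fun j hj => mul_nonneg (haj j hj).le (Real.rpow_nonneg hs _))
      (Finset.mem_Icc.mpr ⟨hk, le_rfl⟩)
    linarith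
  have hup : ∀ s : ℝ, 0 ≤ s → g s ≤ C * (1 + s) ^ b := by
    intro s hs
    rw [hg, hCdef, add_mul, Finset.sum_mul]
    have h1 : (1 : ℝ) ≤ (1 + s) ^ b := Real.one_le_rpow (by linarith) hb.le
    refine add_le_add (by nlinarith) (Finset.sum_le_sum fun j hj => ?_)
    refine mul_le_mul_of_nonneg_left ?_ (haj j hj).le
    exact (Real.rpow_le_rpow hs (by linarith) (hαpos j hj)).trans
      (Real.rpow_le_rpow_of_exponent_le (by linarith) (hαle j hj))
  set m := min (a 0) (a k)
  set n := min 1 (a k)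
  have hmpos : 0 < m := lt_min ha0 hak
  have hnpos : 0 < n := lt_min one_pos hak
  have hc : 0 < m / 2 ^ b := by positivity
  have hd : 0 < n / 2 ^ (b + 1) := by positivity
  have hD : 0 < 1 + C := by positivity
  have key : ∀ ξ : ℝ, 0 ≤ ξ →
      m / 2 ^ b / (1 + C) ^ aa * (1 + ξ) ^ aa ≤ g (Ginv ξ) ∧
        g (Ginv ξ) ≤ C / (n / 2 ^ (b + 1)) ^ aa * (1 + ξ) ^ aa := by
    intro ξ hξ
    obtain ⟨hs, hGs⟩ := hGinv2 ξ hξ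
    rw [hG] at hGs
    generalize Ginv ξ = s at hs hGs ⊢
    have hl := hlow s hs
    have hu := hup s hs
    have hsb : 0 ≤ s ^ b := by positivity
    have hsb1 : s ^ (b + 1) = s ^ b * s := Real.rpow_add_one' hs (by positivity)
    have hsb2 : (1 + s) ^ (b + 1) = (1 + s) ^ b * (1 + s) :=
      Real.rpow_add_one' (by linarith) (by positivity)
    have h1 : (1 : ℝ) ≤ (1 + s) ^ b := Real.one_le_rpow (by linarith) hb.le
    rw [haa]
    refine comparable_rpow_div hb hc hC hd hD hs hξ ?_ hu ?_ ?_
    · rw [div_mul_eq_mul_div, div_le_iff₀ (by positivity)]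
      calc m * (1 + s) ^ b ≤ m * (2 ^ b * (1 + s ^ b)) :=
            mul_le_mul_of_nonneg_left (one_add_rpow_le_two_rpow_mul hb hs) hmpos.le
        _ = (m + m * s ^ b) * 2 ^ b := by ring
        _ ≤ (a 0 + a k * s ^ b) * 2 ^ b := by
            gcongr
            · exact min_le_left _ _
            · exact min_le_right _ _
        _ ≤ g s * 2 ^ b := by gcongr
    · rw [div_mul_eq_mul_div, div_le_iff₀ (by positivity)]
      calc n * (1 + s) ^ (b + 1) ≤ n * (2 ^ (b + 1) * (1 + s ^ (b + 1))) :=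
            mul_le_mul_of_nonneg_left (one_add_rpow_le_two_rpow_mul (by positivity) hs) hnpos.le
        _ = (n + s * (n * s ^ b)) * 2 ^ (b + 1) := by rw [hsb1]; ring
        _ ≤ (1 + s * (a k * s ^ b)) * 2 ^ (b + 1) := by
            gcongr
            · exact min_le_left _ _
            · exact min_le_right _ _
        _ ≤ (1 + ξ) * 2 ^ (b + 1) := by
            rw [← hGs]
            gcongr
            linarith
    · have h2 : s * g s ≤ s * (C * (1 + s) ^ b) := mul_le_mul_of_nonneg_left hu hs
      have h3 : 0 ≤ C * (1 + s) ^ b := by positivity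
      rw [← hGs, hsb2]
      nlinarith [mul_nonneg (zero_le_one.trans h1) hs]
  have haa0 : 0 ≤ aa := by rw [haa]; positivity
  have hC₁ : 0 < (m / 2 ^ b / (1 + C) ^ aa)⁻¹ := by positivity
  refine ⟨(C / (n / 2 ^ (b + 1)) ^ aa)⁻¹, (m / 2 ^ b / (1 + C) ^ aa)⁻¹, by positivity, hC₁,
    fun ξ hξ => ?_⟩
  obtain ⟨h1, h2⟩ := key ξ hξ
  have hpos : 0 < m / 2 ^ b / (1 + C) ^ aa * (1 + ξ) ^ aa := by positivity
  rw [hK, one_div, Real.rpow_neg (by linarith), ← mul_inv, ← mul_inv]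
  refine ⟨inv_anti₀ (hpos.trans_le h1) h2, inv_anti₀ hpos h1, inv_anti₀ (inv_pos.mp hC₁) ?_⟩
  exact le_mul_of_one_le_right (inv_pos.mp hC₁).le (Real.one_le_rpow (by linarith) haa0)
end

section
/- Let g(s) = a₀ + Σ_{j=1}^k a_j s^{α_j} with k ≥ 1, coefficients a₀, a₁, …, a_k > 0 and real exponents 0 < α₁ < … < α_k, and set a = α_k/(α_k+1), G(s) = s·g(s), K(ξ) = 1/g(G⁻¹(ξ)). Then there exist constants C₁, C₂ > 0 (depending only on g) such that for all ξ ≥ 0: C₂·ξ^{2−a} − 1 ≤ K(ξ)·ξ² ≤ C₁·ξ^{2−a}. -/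
open Set

/-- The two-sided comparison of `c ^ (1/(p+1)) * (s * t) ^ (p/(p+1))` with `t` rests on writing the
former as a `(p+1)`-st root. -/
lemma root_mul_rpow_eq {c s t p : ℝ} (hc : 0 ≤ c) (hs : 0 ≤ s) (ht : 0 ≤ t) :
    c ^ (1 / (p + 1)) * (s * t) ^ (p / (p + 1)) = (c * s ^ p * t ^ p) ^ (1 / (p + 1)) := by
  rw [mul_assoc, ← Real.mul_rpow hs ht, Real.mul_rpow hc (by positivity),
    ← Real.rpow_mul (by positivity), mul_one_div]

lemma rpow_mul_rpow_root {t p : ℝ} (ht : 0 < t) (hp : 0 < p) :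
    (t * t ^ p) ^ (1 / (p + 1)) = t := by
  rw [← Real.rpow_one_add' ht.le (by positivity), ← Real.rpow_mul ht.le, add_comm 1 p,
    mul_one_div_cancel (by positivity), Real.rpow_one]

lemma root_mul_rpow_le {c s t p : ℝ} (hc : 0 ≤ c) (hs : 0 ≤ s) (ht : 0 < t) (hp : 0 < p)
    (h : c * s ^ p ≤ t) : c ^ (1 / (p + 1)) * (s * t) ^ (p / (p + 1)) ≤ t := by
  rw [root_mul_rpow_eq hc hs ht.le]
  calc (c * s ^ p * t ^ p) ^ (1 / (p + 1)) ≤ (t * t ^ p) ^ (1 / (p + 1)) := by gcongr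
    _ = t := rpow_mul_rpow_root ht hp

lemma le_root_mul_rpow {c s t p : ℝ} (hc : 0 ≤ c) (hs : 0 ≤ s) (ht : 0 < t) (hp : 0 < p)
    (h : t ≤ c * s ^ p) : t ≤ c ^ (1 / (p + 1)) * (s * t) ^ (p / (p + 1)) := by
  rw [root_mul_rpow_eq hc hs ht.le]
  calc t = (t * t ^ p) ^ (1 / (p + 1)) := (rpow_mul_rpow_root ht hp).symm
    _ ≤ (c * s ^ p * t ^ p) ^ (1 / (p + 1)) := by gcongr

/-- With `a = α_k/(α_k+1)`, `G(s) = s·g(s)`, `K(ξ) = 1/g(G⁻¹(ξ))`,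
there exist constants `C₁, C₂ > 0` such that
`C₂·ξ^{2-a} - 1 ≤ K(ξ)·ξ² ≤ C₁·ξ^{2-a}` for all `ξ ≥ 0`. -/
theorem stmt_3
    (k : ℕ) (hk : 1 ≤ k) (a α : ℕ → ℝ)
    (ha : ∀ j ≤ k, 0 < a j)
    (hα1 : 0 < α 1)
    (hαmono : ∀ i j : ℕ, 1 ≤ i → i < j → j ≤ k → α i < α j)
    (g G Ginv K : ℝ → ℝ)
    (hg : ∀ s : ℝ, g s = a 0 + ∑ j ∈ Finset.Icc 1 k, a j * s ^ (α j))
    (hG : ∀ s : ℝ, G s = s * g s)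
    (hGinv1 : ∀ s : ℝ, 0 ≤ s → Ginv (G s) = s)
    (hGinv2 : ∀ ξ : ℝ, 0 ≤ ξ → 0 ≤ Ginv ξ ∧ G (Ginv ξ) = ξ)
    (hK : ∀ ξ : ℝ, K ξ = 1 / g (Ginv ξ))
    (aa : ℝ) (haa : aa = α k / (α k + 1)) :
    ∃ C₁ C₂ : ℝ, 0 < C₁ ∧ 0 < C₂ ∧ ∀ ξ : ℝ, 0 ≤ ξ →
      C₂ * ξ ^ (2 - aa) - 1 ≤ K ξ * ξ ^ 2 ∧ K ξ * ξ ^ 2 ≤ C₁ * ξ ^ (2 - aa) := by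
  have hle : ∀ j ∈ Finset.Icc 1 k, 0 < α j ∧ α j ≤ α k := by
    intro j hj
    obtain ⟨h1, h2⟩ := Finset.mem_Icc.1 hj
    constructor
    · rcases h1.eq_or_lt with rfl | h
      · exact hα1
      · exact hα1.trans (hαmono 1 j le_rfl h h2)
    · rcases h2.eq_or_lt with rfl | h
      · exact le_rfl
      · exact (hαmono j k h1 h le_rfl).le
  have hkmem : k ∈ Finset.Icc 1 k := Finset.mem_Icc.2 ⟨hk, le_rfl⟩
  have hpos : ∀ j ∈ Finset.Icc 1 k, 0 < a j := fun j hj => ha j (Finset.mem_Icc.1 hj).2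
  have hp : 0 < α k := (hle k hkmem).1
  have ha0 : 0 < a 0 := ha 0 (Nat.zero_le k)
  have hak : 0 < a k := ha k le_rfl
  set p := α k
  have hp1 : 0 < p + 1 := by positivity
  have haa1 : aa < 1 := by rw [haa, div_lt_one hp1]; linarith
  set A := a 0 + ∑ j ∈ Finset.Icc 1 k, a j with hA
  have hA0 : 0 < A := add_pos_of_pos_of_nonneg ha0 (Finset.sum_nonneg fun j hj => (hpos j hj).le)
  have hglow : ∀ s, 0 ≤ s → a 0 + a k * s ^ p ≤ g s := by
    intro s hs
    rw [hg]
    gcongr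
    exact Finset.single_le_sum (f := fun j => a j * s ^ α j)
      (fun j hj => mul_nonneg (hpos j hj).le (Real.rpow_nonneg hs _)) hkmem
  have hgone : ∀ s, 0 ≤ s → s ≤ 1 → g s ≤ A := by
    intro s hs hs1
    rw [hg, hA]
    gcongr with j hj
    exact mul_le_of_le_one_right (hpos j hj).le (Real.rpow_le_one hs hs1 (hle j hj).1.le)
  have hgup : ∀ s, 1 ≤ s → g s ≤ A * s ^ p := by
    intro s hs
    rw [hg, hA, add_mul, Finset.sum_mul]
    refine add_le_add (le_mul_of_one_le_right ha0.le (Real.one_le_rpow hs hp.le))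
      (Finset.sum_le_sum fun j hj => ?_)
    exact mul_le_mul_of_nonneg_left (Real.rpow_le_rpow_of_exponent_le hs (hle j hj).2)
      (hpos j hj).le
  set D := a k ^ (1 / (p + 1))
  set E := A ^ (1 / (p + 1))
  have hD : 0 < D := Real.rpow_pos_of_pos hak _
  have hE : 0 < E := Real.rpow_pos_of_pos hA0 _
  have hF : 0 < A ^ (2 - aa) := Real.rpow_pos_of_pos hA0 _
  refine ⟨1 / D, min (1 / E) (1 / A ^ (2 - aa)), by positivity, by positivity, fun ξ hξ => ?_⟩
  obtain ⟨hs, hGs⟩ := hGinv2 ξ hξ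
  rw [hK]
  set s := Ginv ξ
  have hlow := hglow s hs
  have hsp : 0 ≤ a k * s ^ p := by positivity
  have hgs : 0 < g s := by linarith
  have hξs : ξ = s * g s := by rw [← hGs, hG]
  have hpow : 0 ≤ ξ ^ (2 - aa) := Real.rpow_nonneg hξ _
  have hsq : ξ ^ 2 = ξ ^ aa * ξ ^ (2 - aa) := by
    rw [← Real.rpow_add' hξ (by norm_num), ← Real.rpow_natCast]
    norm_num
  have hquot : 1 / g s * ξ ^ 2 = ξ ^ aa / g s * ξ ^ (2 - aa) := by rw [hsq]; ring
  constructor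
  · rcases le_total s 1 with hs1 | hs1
    · have hξA : ξ ≤ A := by
        rw [hξs]
        exact (mul_le_of_le_one_left hgs.le hs1).trans (hgone s hs hs1)
      have h1 : min (1 / E) (1 / A ^ (2 - aa)) * ξ ^ (2 - aa) ≤ 1 :=
        calc _ ≤ 1 / A ^ (2 - aa) * A ^ (2 - aa) :=
              mul_le_mul (min_le_right _ _) (Real.rpow_le_rpow hξ hξA (by linarith)) hpow
                (by positivity)
          _ = 1 := one_div_mul_cancel hF.ne'
      have h2 : 0 ≤ 1 / g s * ξ ^ 2 := by positivity
      linarith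
    · have h1 : g s ≤ E * ξ ^ aa := by
        rw [hξs, haa]
        exact le_root_mul_rpow hA0.le hs hgs hp (hgup s hs1)
      have h2 : 1 / E ≤ ξ ^ aa / g s := by
        rw [div_le_div_iff₀ hE hgs]
        linarith
      have h3 := mul_le_mul_of_nonneg_right ((min_le_left (1 / E) (1 / A ^ (2 - aa))).trans h2) hpow
      linarith
  · rw [hquot]
    refine mul_le_mul_of_nonneg_right ?_ hpow
    have h1 : D * ξ ^ aa ≤ g s := by
      rw [hξs, haa]
      exact root_mul_rpow_le hak.le hs hgs hp (by linarith)
    rw [div_le_div_iff₀ hgs hD]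
    linarith
end

section
/- Let g(s) = a₀ + Σ_{j=1}^k a_j s^{α_j} with k ≥ 1, coefficients a₀, a₁, …, a_k > 0 and real exponents 0 < α₁ < … < α_k, set G(s) = s·g(s), K(ξ) = 1/g(G⁻¹(ξ)), and define H(ξ) = ∫_0^{ξ²} K(√s) ds for ξ ≥ 0. Then for every ξ ≥ 0: K(ξ)·ξ² ≤ H(ξ) ≤ 2·K(ξ)·ξ². -/
open Set

/-- If `f` is antitone on `[0, ∞)` and `t * f t ≤ x * f x` for `0 < t ≤ x`, then
`∫_0^{x²} f(√s) ds` lies between `f x * x²` and `2 * f x * x²`. -/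
lemma integral_comp_sqrt_bounds {f : ℝ → ℝ} {x : ℝ} (hx : 0 ≤ x)
    (hf : AntitoneOn f (Ici 0)) (hmul : ∀ t, 0 < t → t ≤ x → t * f t ≤ x * f x) :
    f x * x ^ 2 ≤ ∫ s in (0:ℝ)..(x ^ 2), f (√s) ∧
      ∫ s in (0:ℝ)..(x ^ 2), f (√s) ≤ 2 * f x * x ^ 2 := by
  have hx2 : (0:ℝ) ≤ x ^ 2 := sq_nonneg x
  have hanti : AntitoneOn (fun s : ℝ => f (√s)) (uIcc 0 (x ^ 2)) := fun s _ t _ hst =>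
    hf (Real.sqrt_nonneg s) (Real.sqrt_nonneg t) (Real.sqrt_le_sqrt hst)
  have hint := hanti.intervalIntegrable (μ := MeasureTheory.volume)
  have hle : ∀ s ≤ x ^ 2, √s ≤ x := fun s hs => Real.sqrt_le_iff.2 ⟨hx, hs⟩
  constructor
  · calc f x * x ^ 2 = ∫ _ in (0:ℝ)..(x ^ 2), f x := by simp [mul_comm]
      _ ≤ _ := intervalIntegral.integral_mono_on hx2 (by simp) hint fun s hs =>
        hf (Real.sqrt_nonneg s) hx (hle s hs.2)
  · have hpow : IntervalIntegrable (fun s : ℝ => x * f x * s ^ (-(1 / 2) : ℝ))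
        MeasureTheory.volume 0 (x ^ 2) :=
      (intervalIntegral.intervalIntegrable_rpow' (by norm_num)).const_mul _
    calc _ ≤ ∫ s in (0:ℝ)..(x ^ 2), x * f x * s ^ (-(1 / 2) : ℝ) := by
          refine intervalIntegral.integral_mono_on_of_le_Ioo hx2 hint hpow fun s hs => ?_
          have hs0 : 0 < √s := Real.sqrt_pos.2 hs.1
          rw [Real.rpow_neg hs.1.le, ← Real.sqrt_eq_rpow, ← div_eq_mul_inv, le_div_iff₀ hs0,
            mul_comm]
          exact hmul _ hs0 (hle s hs.2.le)
      _ = 2 * f x * x ^ 2 := by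
          rw [intervalIntegral.integral_const_mul, integral_rpow (Or.inl (by norm_num)),
            show (-(1 / 2) + 1 : ℝ) = 1 / 2 by norm_num, ← Real.sqrt_eq_rpow,
            Real.sqrt_sq hx, Real.zero_rpow (by norm_num)]
          ring

/-- With `G(s) = s·g(s)`, `K(ξ) = 1/g(G⁻¹(ξ))` and
`H(ξ) = ∫_0^{ξ²} K(√s) ds`, one has `K(ξ)·ξ² ≤ H(ξ) ≤ 2·K(ξ)·ξ²`
for every `ξ ≥ 0`. -/
theorem stmt_4
    (k : ℕ) (hk : 1 ≤ k) (a α : ℕ → ℝ)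
    (ha : ∀ j ≤ k, 0 < a j)
    (hα1 : 0 < α 1)
    (hαmono : ∀ i j : ℕ, 1 ≤ i → i < j → j ≤ k → α i < α j)
    (g G Ginv K H : ℝ → ℝ)
    (hg : ∀ s : ℝ, g s = a 0 + ∑ j ∈ Finset.Icc 1 k, a j * s ^ (α j))
    (hG : ∀ s : ℝ, G s = s * g s)
    (hGinv1 : ∀ s : ℝ, 0 ≤ s → Ginv (G s) = s)
    (hGinv2 : ∀ ξ : ℝ, 0 ≤ ξ → 0 ≤ Ginv ξ ∧ G (Ginv ξ) = ξ)
    (hK : ∀ ξ : ℝ, K ξ = 1 / g (Ginv ξ))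
    (hH : ∀ ξ : ℝ, H ξ = ∫ s in (0:ℝ)..(ξ ^ 2), K (Real.sqrt s)) :
    ∀ ξ : ℝ, 0 ≤ ξ → K ξ * ξ ^ 2 ≤ H ξ ∧ H ξ ≤ 2 * K ξ * ξ ^ 2 := by
  have hα : ∀ j ∈ Finset.Icc 1 k, 0 < α j := by
    intro j hj
    obtain ⟨h1, h2⟩ := Finset.mem_Icc.1 hj
    rcases h1.eq_or_lt with rfl | h
    · exact hα1
    · exact hα1.trans (hαmono 1 j le_rfl h h2)
  have ha' : ∀ j ∈ Finset.Icc 1 k, 0 ≤ a j := fun j hj => (ha j (Finset.mem_Icc.1 hj).2).le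
  have hgpos : ∀ s, 0 ≤ s → 0 < g s := by
    intro s hs
    rw [hg]
    exact add_pos_of_pos_of_nonneg (ha 0 k.zero_le)
      (Finset.sum_nonneg fun j hj => mul_nonneg (ha' j hj) (Real.rpow_nonneg hs _))
  have hgmono : MonotoneOn g (Ici 0) := by
    intro s hs t _ hst
    rw [hg, hg]
    gcongr with j hj
    · exact ha' j hj
    · exact (hα j hj).le
  have hGmono : StrictMonoOn G (Ici 0) := by
    intro s hs t ht hst
    rw [hG, hG]
    exact mul_lt_mul hst (hgmono hs ht hst.le) (hgpos s hs) ht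
  have hinv : MonotoneOn Ginv (Ici 0) := by
    intro x hx y hy hxy
    rw [← hGmono.le_iff_le (hGinv2 x hx).1 (hGinv2 y hy).1, (hGinv2 x hx).2, (hGinv2 y hy).2]
    exact hxy
  have hKanti : AntitoneOn K (Ici 0) := by
    intro x hx y hy hxy
    rw [hK, hK]
    exact one_div_le_one_div_of_le (hgpos _ (hGinv2 x hx).1)
      (hgmono (hGinv2 x hx).1 (hGinv2 y hy).1 (hinv hx hy hxy))
  have hmul : ∀ x, 0 ≤ x → x * K x = Ginv x := by
    intro x hx
    obtain ⟨h0, h1⟩ := hGinv2 x hx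
    rw [hK, mul_one_div, div_eq_iff (hgpos _ h0).ne', ← hG, h1]
  intro ξ hξ
  rw [hH]
  refine integral_comp_sqrt_bounds hξ hKanti fun t ht htξ => ?_
  rw [hmul t ht.le, hmul ξ hξ]
  exact hinv ht.le hξ htξ
end

section
/- Let g(s) = a₀ + Σ_{j=1}^k a_j s^{α_j} with k ≥ 1, coefficients a₀, a₁, …, a_k > 0 and real exponents 0 < α₁ < … < α_k, set a = α_k/(α_k+1), G(s) = s·g(s), K(ξ) = 1/g(G⁻¹(ξ)), and H(ξ) = ∫_0^{ξ²} K(√s) ds. Then there exist constants C₁, C₂ > 0 (depending only on g) such that for all ξ ≥ 0: C₁·ξ^{2−a} − 1 ≤ H(ξ) ≤ C₂·ξ^{2−a}. -/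
open Set

theorem rpow_inv_mul_rpow_eq {α M s y : ℝ} (hM : 0 ≤ M) (hs : 0 ≤ s)
    (hy : 0 ≤ y) :
    M ^ (1 / (α + 1)) * (s * y) ^ (α / (α + 1)) = (M * s ^ α * y ^ α) ^ (1 / (α + 1)) := by
  rw [mul_assoc, ← Real.mul_rpow hs hy,
    Real.mul_rpow hM (Real.rpow_nonneg (mul_nonneg hs hy) _),
    ← Real.rpow_mul (mul_nonneg hs hy), mul_one_div]

theorem mul_rpow_self_rpow_inv {α y : ℝ} (hα : 0 < α) (hy : 0 < y) :
    (y * y ^ α) ^ (1 / (α + 1)) = y := by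
  have h : y * y ^ α = y ^ (α + 1) := by rw [Real.rpow_add_one hy.ne', mul_comm]
  rw [h, ← Real.rpow_mul hy.le, mul_one_div_cancel (by positivity), Real.rpow_one]

/-- A power lower bound for `y` in terms of `s` gives one in terms of `s * y`. -/
theorem rpow_inv_mul_rpow_le {α M s y : ℝ} (hα : 0 < α) (hM : 0 ≤ M) (hs : 0 ≤ s)
    (hy : 0 < y) (h : M * s ^ α ≤ y) :
    M ^ (1 / (α + 1)) * (s * y) ^ (α / (α + 1)) ≤ y := by
  rw [rpow_inv_mul_rpow_eq hM hs hy.le]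
  conv_rhs => rw [← mul_rpow_self_rpow_inv hα hy]
  gcongr

/-- A power upper bound for `y` in terms of `s` gives one in terms of `s * y`. -/
theorem le_rpow_inv_mul_rpow {α M s y : ℝ} (hα : 0 < α) (hM : 0 ≤ M) (hs : 0 ≤ s)
    (hy : 0 < y) (h : y ≤ M * s ^ α) :
    y ≤ M ^ (1 / (α + 1)) * (s * y) ^ (α / (α + 1)) := by
  rw [rpow_inv_mul_rpow_eq hM hs hy.le]
  conv_lhs => rw [← mul_rpow_self_rpow_inv hα hy]
  gcongr

/-- If `f` is antitone on `[0, ∞)`, lies between `1 / (C * (1 + x ^ p))` and `D * x ^ (-p)`,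
then `∫ s in 0..ξ ^ 2, f √s` is comparable to `ξ ^ (2 - p)` up to an additive constant. -/
theorem integral_comp_sqrt_bounds_s5 {f : ℝ → ℝ} {p C D : ℝ} (hp0 : 0 < p) (hp1 : p < 1)
    (hC : 0 < C) (hD : 0 < D) (hf : AntitoneOn f (Ici 0))
    (hlow : ∀ x, 0 ≤ x → 1 / (C * (1 + x ^ p)) ≤ f x)
    (hupp : ∀ x, 0 < x → f x ≤ D * x ^ (-p)) :
    ∃ C₁ C₂ : ℝ, 0 < C₁ ∧ 0 < C₂ ∧ ∀ ξ : ℝ, 0 ≤ ξ →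
      C₁ * ξ ^ (2 - p) - 1 ≤ ∫ s in (0:ℝ)..(ξ ^ 2), f √s ∧
      ∫ s in (0:ℝ)..(ξ ^ 2), f √s ≤ C₂ * ξ ^ (2 - p) := by
  refine ⟨min 1 (1 / (2 * C)), D / (1 - p / 2), by positivity,
    div_pos hD (by linarith), fun ξ hξ => ?_⟩
  have hint : IntervalIntegrable (fun s => f √s) MeasureTheory.volume 0 (ξ ^ 2) :=
    AntitoneOn.intervalIntegrable fun x _ y _ hxy =>
      hf (Real.sqrt_nonneg x) (Real.sqrt_nonneg y) (Real.sqrt_le_sqrt hxy)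
  constructor
  · have hconst : ξ ^ 2 * (1 / (C * (1 + ξ ^ p))) ≤ ∫ s in (0:ℝ)..(ξ ^ 2), f √s := by
      have h := intervalIntegral.integral_mono_on (μ := MeasureTheory.volume) (sq_nonneg ξ)
        (intervalIntegrable_const (c := 1 / (C * (1 + ξ ^ p)))) hint fun x hx => by
          refine le_trans ?_ (hlow _ (Real.sqrt_nonneg x))
          have : √x ≤ ξ := Real.sqrt_le_iff.mpr ⟨hξ, hx.2⟩
          gcongr
      rwa [intervalIntegral.integral_const, sub_zero, smul_eq_mul] at h
    rcases le_total ξ 1 with h1 | h1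
    · have h2 : ξ ^ (2 - p) ≤ 1 := Real.rpow_le_one hξ h1 (by linarith)
      have h3 : min 1 (1 / (2 * C)) * ξ ^ (2 - p) ≤ 1 :=
        mul_le_one₀ (min_le_left _ _) (Real.rpow_nonneg hξ _) h2
      have h4 : 0 ≤ ξ ^ 2 * (1 / (C * (1 + ξ ^ p))) := by positivity
      linarith
    · have hξ0 : 0 < ξ := by linarith
      have h2 : 1 ≤ ξ ^ p := Real.one_le_rpow h1 hp0.le
      have h3 : min 1 (1 / (2 * C)) * ξ ^ (2 - p) ≤ 1 / (2 * C) * ξ ^ (2 - p) := by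
        gcongr
        exact min_le_right _ _
      have h4 : 1 / (2 * C) * ξ ^ (2 - p) = ξ ^ 2 * (1 / (C * (ξ ^ p + ξ ^ p))) := by
        rw [Real.rpow_sub hξ0, Real.rpow_two]
        field_simp
        ring
      have h5 : ξ ^ 2 * (1 / (C * (ξ ^ p + ξ ^ p))) ≤ ξ ^ 2 * (1 / (C * (1 + ξ ^ p))) := by
        gcongr
      linarith
  · have hr : (-1 : ℝ) < -(p / 2) := by linarith
    have h := intervalIntegral.integral_mono_on_of_le_Ioo (μ := MeasureTheory.volume) (sq_nonneg ξ) hint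
      ((intervalIntegral.intervalIntegrable_rpow' (a := 0) (b := ξ ^ 2) hr).const_mul D)
      fun x hx => by
        refine (hupp _ (Real.sqrt_pos.mpr hx.1)).trans_eq ?_
        rw [Real.sqrt_eq_rpow, ← Real.rpow_mul hx.1.le]
        ring_nf
    refine h.trans_eq ?_
    have hpow : (ξ ^ 2) ^ (-(p / 2) + 1) = ξ ^ (2 - p) := by
      rw [← Real.rpow_two, ← Real.rpow_mul hξ]
      ring_nf
    rw [intervalIntegral.integral_const_mul, integral_rpow (Or.inl hr), hpow,
      Real.zero_rpow (by linarith)]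
    ring

/-- With `a = α_k/(α_k+1)`, `G(s) = s·g(s)`, `K(ξ) = 1/g(G⁻¹(ξ))`
and `H(ξ) = ∫_0^{ξ²} K(√s) ds`, there exist constants `C₁, C₂ > 0` such that
`C₁·ξ^{2-a} - 1 ≤ H(ξ) ≤ C₂·ξ^{2-a}` for all `ξ ≥ 0`. -/
theorem stmt_5
    (k : ℕ) (hk : 1 ≤ k) (a α : ℕ → ℝ)
    (ha : ∀ j ≤ k, 0 < a j)
    (hα1 : 0 < α 1)
    (hαmono : ∀ i j : ℕ, 1 ≤ i → i < j → j ≤ k → α i < α j)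
    (g G Ginv K H : ℝ → ℝ)
    (hg : ∀ s : ℝ, g s = a 0 + ∑ j ∈ Finset.Icc 1 k, a j * s ^ (α j))
    (hG : ∀ s : ℝ, G s = s * g s)
    (hGinv1 : ∀ s : ℝ, 0 ≤ s → Ginv (G s) = s)
    (hGinv2 : ∀ ξ : ℝ, 0 ≤ ξ → 0 ≤ Ginv ξ ∧ G (Ginv ξ) = ξ)
    (hK : ∀ ξ : ℝ, K ξ = 1 / g (Ginv ξ))
    (hH : ∀ ξ : ℝ, H ξ = ∫ s in (0:ℝ)..(ξ ^ 2), K (Real.sqrt s))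
    (aa : ℝ) (haa : aa = α k / (α k + 1)) :
    ∃ C₁ C₂ : ℝ, 0 < C₁ ∧ 0 < C₂ ∧ ∀ ξ : ℝ, 0 ≤ ξ →
      C₁ * ξ ^ (2 - aa) - 1 ≤ H ξ ∧ H ξ ≤ C₂ * ξ ^ (2 - aa) := by
  have hmono : ∀ j ∈ Finset.Icc 1 k, 0 < α j ∧ α j ≤ α k := by
    intro j hj
    obtain ⟨h1, h2⟩ := Finset.mem_Icc.mp hj
    constructor
    · rcases h1.eq_or_lt with rfl | h
      · exact hα1
      · exact hα1.trans (hαmono 1 j le_rfl h h2)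
    · rcases h2.eq_or_lt with rfl | h
      · exact le_rfl
      · exact (hαmono j k h1 h le_rfl).le
  have haj : ∀ j ∈ Finset.Icc 1 k, 0 < a j := fun j hj => ha j (Finset.mem_Icc.mp hj).2
  have hkmem : k ∈ Finset.Icc 1 k := Finset.mem_Icc.mpr ⟨hk, le_rfl⟩
  have hαk : 0 < α k := (hmono k hkmem).1
  have ha0 : 0 < a 0 := ha 0 (Nat.zero_le k)
  have hak : 0 < a k := ha k le_rfl
  have hgmono : MonotoneOn g (Ici 0) := by
    intro x hx y _ hxy
    have hx0 : 0 ≤ x := hx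
    rw [hg, hg]
    gcongr with j hj
    · exact (haj j hj).le
    · exact (hmono j hj).1.le
  have hglow : ∀ s, 0 ≤ s → a k * s ^ α k ≤ g s ∧ 0 < g s := by
    intro s hs
    have hnonneg : ∀ j ∈ Finset.Icc 1 k, 0 ≤ a j * s ^ α j := fun j hj =>
      mul_nonneg (haj j hj).le (Real.rpow_nonneg hs _)
    have h1 := Finset.single_le_sum hnonneg hkmem
    have h2 := Finset.sum_nonneg hnonneg
    rw [hg]
    constructor <;> linarith
  set A : ℝ := a 0 + ∑ j ∈ Finset.Icc 1 k, a j with hA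
  have hApos : 0 < A := add_pos_of_pos_of_nonneg ha0 (Finset.sum_nonneg fun j hj => (haj j hj).le)
  have hgone : g 1 = A := by simp [hg, hA]
  have hgupp : ∀ s, 1 ≤ s → g s ≤ A * s ^ α k := by
    intro s hs
    rw [hg, hA, add_mul, Finset.sum_mul]
    gcongr with j hj
    · exact le_mul_of_one_le_right ha0.le (Real.one_le_rpow hs hαk.le)
    · exact (haj j hj).le
    · exact (hmono j hj).2
  have hGinvmono : MonotoneOn Ginv (Ici 0) := by
    intro x hx y hy hxy
    obtain ⟨hx0, hx1⟩ := hGinv2 x hx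
    obtain ⟨hy0, hy1⟩ := hGinv2 y hy
    by_contra! hlt
    have h1 : G (Ginv y) < G (Ginv x) := by
      rw [hG, hG]
      exact mul_lt_mul hlt (hgmono hy0 hx0 hlt.le) (hglow _ hy0).2 hx0
    linarith
  have hKanti : AntitoneOn K (Ici 0) := by
    intro x hx y hy hxy
    rw [hK, hK]
    exact one_div_le_one_div_of_le (hglow _ (hGinv2 x hx).1).2
      (hgmono (hGinv2 x hx).1 (hGinv2 y hy).1 (hGinvmono hx hy hxy))
  have hp0 : 0 < aa := haa ▸ by positivity
  have hp1 : aa < 1 := by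
    rw [haa, div_lt_one (by positivity)]
    linarith
  simp only [hH]
  have hc : 0 < a k ^ (1 / (α k + 1)) := Real.rpow_pos_of_pos hak _
  refine integral_comp_sqrt_bounds_s5 (C := max A (A ^ (1 / (α k + 1))))
    (D := 1 / a k ^ (1 / (α k + 1))) hp0 hp1 (lt_max_of_lt_left hApos)
    (one_div_pos.mpr hc) hKanti ?_ ?_
  · intro x hx
    obtain ⟨hs, hsx⟩ := hGinv2 x hx
    have hgp := (hglow _ hs).2
    have hxp : 0 ≤ x ^ aa := Real.rpow_nonneg hx _
    rw [hK]
    refine one_div_le_one_div_of_le hgp ?_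
    rcases le_total (Ginv x) 1 with h1 | h1
    · calc g (Ginv x) ≤ A := hgone ▸ hgmono hs (mem_Ici.mpr zero_le_one) h1
        _ ≤ max A (A ^ (1 / (α k + 1))) := le_max_left _ _
        _ ≤ _ := le_mul_of_one_le_right (hApos.le.trans (le_max_left _ _)) (by linarith)
    · have h := le_rpow_inv_mul_rpow hαk hApos.le hs hgp (hgupp _ h1)
      rw [← hG, hsx, ← haa] at h
      refine h.trans ?_
      gcongr
      · exact le_max_right _ _
      · linarith
  · intro x hx
    obtain ⟨hs, hsx⟩ := hGinv2 x hx.le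
    obtain ⟨hgl, hgp⟩ := hglow _ hs
    have h := rpow_inv_mul_rpow_le hαk hak.le hs hgp hgl
    rw [← hG, hsx, ← haa] at h
    rw [hK, Real.rpow_neg hx.le, ← one_div, one_div_mul_one_div]
    exact one_div_le_one_div_of_le (mul_pos hc (Real.rpow_pos_of_pos hx _)) h
end

section
/- Let U ⊂ ℝⁿ (n ≥ 2) be a bounded open set, let g(s) = a₀ + Σ_{j=1}^k a_j s^{α_j} with k ≥ 1, coefficients a₀, a₁, …, a_k > 0 and real exponents 0 < α₁ < … < α_k, set a = α_k/(α_k+1), G(s) = s·g(s), K(ξ) = 1/g(G⁻¹(ξ)). Then there exists a constant C ≥ 1 (depending only on g, n and U) such that for all continuously differentiable functions u₁, u₂ : U → ℝ with ∫_U |∇u₁|^{2−a} dx < ∞ and ∫_U |∇u₂|^{2−a} dx < ∞, one has ∫_U (K(|∇u₁|)∇u₁ − K(|∇u₂|)∇u₂) · ∇(u₁ − u₂) dx ≥ C_Φ⁻¹ · (∫_U |∇(u₁ − u₂)|^{2−a} dx)^{2/(2−a)}, where C_Φ = C·(1 + max(‖∇u₁‖_{L^{2−a}(U)}, ‖∇u₂‖_{L^{2−a}(U)}))^a.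 -/
open Set MeasureTheory
open scoped RealInnerProductSpace

theorem le_inner_smul_sub_smul {E : Type*} [NormedAddCommGroup E] [InnerProductSpace ℝ E]
    {y z : E} {A B c : ℝ} (hA : 0 ≤ A) (hAB : A ≤ B) (hc : c ≤ 1) (hyz : ‖z‖ ≤ ‖y‖)
    (h : c * A * (‖y‖ - ‖z‖) ≤ A * ‖y‖ - B * ‖z‖) :
    c * A * ‖y - z‖ ^ 2 ≤ ⟪A • y - B • z, y - z⟫ := by
  have h1 : ⟪A • y - B • z, y - z⟫ = A * ‖y‖ ^ 2 + B * ‖z‖ ^ 2 - (A + B) * ⟪y, z⟫ := by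
    simp only [inner_sub_left, inner_sub_right, real_inner_smul_left,
      real_inner_self_eq_norm_sq, real_inner_comm y z]
    ring
  have h2 : ‖y - z‖ ^ 2 = ‖y‖ ^ 2 - 2 * ⟪y, z⟫ + ‖z‖ ^ 2 := norm_sub_sq_real y z
  have h3 : ⟪y, z⟫ ≤ ‖y‖ * ‖z‖ := real_inner_le_norm y z
  have h4 : 0 ≤ (A + B - 2 * (c * A)) * (‖y‖ * ‖z‖ - ⟪y, z⟫) :=
    mul_nonneg (by nlinarith) (by linarith)
  have h5 := mul_nonneg (sub_nonneg.2 h) (sub_nonneg.2 hyz)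
  rw [h1, h2]
  nlinarith

theorem rpow_add_one_sub_le {s t β : ℝ} (ht : 0 ≤ t) (hts : t ≤ s) (hβ : 0 < β) :
    s * s ^ β - t * t ^ β ≤ (β + 1) * s ^ β * (s - t) := by
  rcases (ht.trans hts).eq_or_lt with h | hs
  · obtain rfl : t = s := le_antisymm hts (h ▸ ht)
    simp
  have h1 : 0 ≤ t / s := div_nonneg ht hs.le
  have h := one_add_mul_self_le_rpow_one_add (s := t / s - 1) (by linarith)
    (p := β + 1) (by linarith)
  rw [add_sub_cancel, Real.rpow_add_one' h1 (by linarith), Real.div_rpow ht hs.le] at h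
  have h2 : 0 < s ^ β := Real.rpow_pos_of_pos hs β
  have h3 := mul_le_mul_of_nonneg_left h (mul_pos hs h2).le
  have h4 : s * s ^ β * (t ^ β / s ^ β * (t / s)) = t * t ^ β := by field_simp
  have h5 : s * s ^ β * (1 + (β + 1) * (t / s - 1)) =
      s * s ^ β + (β + 1) * s ^ β * (t - s) := by field_simp
  rw [h4, h5] at h3
  linarith

section GeneralizedPolynomial

variable {k : ℕ} {a α : ℕ → ℝ} {g : ℝ → ℝ}

theorem genPoly_mono (ha : ∀ j ≤ k, 0 < a j) (hα : ∀ j ∈ Finset.Icc 1 k, 0 < α j)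
    (hg : ∀ s, g s = a 0 + ∑ j ∈ Finset.Icc 1 k, a j * s ^ α j) {s t : ℝ}
    (ht : 0 ≤ t) (hts : t ≤ s) : g t ≤ g s := by
  rw [hg, hg]
  gcongr with j hj
  · exact (ha j (Finset.mem_Icc.1 hj).2).le
  · exact (hα j hj).le

theorem le_genPoly (ha : ∀ j ≤ k, 0 < a j) (hk : 1 ≤ k)
    (hg : ∀ s, g s = a 0 + ∑ j ∈ Finset.Icc 1 k, a j * s ^ α j) {s : ℝ}
    (hs : 0 ≤ s) : a 0 + a k * s ^ α k ≤ g s := by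
  rw [hg]
  gcongr
  exact Finset.single_le_sum (f := fun j => a j * s ^ α j)
    (fun j hj => mul_nonneg (ha j (Finset.mem_Icc.1 hj).2).le (Real.rpow_nonneg hs _))
    (Finset.mem_Icc.2 ⟨hk, le_rfl⟩)

theorem genPoly_le (ha : ∀ j ≤ k, 0 < a j) (hα : ∀ j ∈ Finset.Icc 1 k, 0 < α j)
    (hαk : ∀ j ∈ Finset.Icc 1 k, α j ≤ α k) (hk : 1 ≤ k)
    (hg : ∀ s, g s = a 0 + ∑ j ∈ Finset.Icc 1 k, a j * s ^ α j) {s : ℝ}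
    (hs : 0 ≤ s) : g s ≤ (a 0 + ∑ j ∈ Finset.Icc 1 k, a j) * (max 1 s) ^ α k := by
  have h0 := hα k (Finset.mem_Icc.2 ⟨hk, le_rfl⟩)
  rw [hg, add_mul, Finset.sum_mul]
  refine add_le_add (le_mul_of_one_le_right (ha 0 (Nat.zero_le _)).le
    (Real.one_le_rpow (le_max_left _ _) h0.le)) (Finset.sum_le_sum fun j hj => ?_)
  refine mul_le_mul_of_nonneg_left ?_ (ha j (Finset.mem_Icc.1 hj).2).le
  exact (Real.rpow_le_rpow hs (le_max_right 1 s) (hα j hj).le).trans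
    (Real.rpow_le_rpow_of_exponent_le (le_max_left _ _) (hαk j hj))

theorem mul_genPoly_sub_le (ha : ∀ j ≤ k, 0 < a j) (hα : ∀ j ∈ Finset.Icc 1 k, 0 < α j)
    (hαk : ∀ j ∈ Finset.Icc 1 k, α j ≤ α k) (hk : 1 ≤ k)
    (hg : ∀ s, g s = a 0 + ∑ j ∈ Finset.Icc 1 k, a j * s ^ α j) {s t : ℝ}
    (ht : 0 ≤ t) (hts : t ≤ s) : s * g s - t * g t ≤ (α k + 1) * g s * (s - t) := by
  have h0 := hα k (Finset.mem_Icc.2 ⟨hk, le_rfl⟩)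
  have ha0 := ha 0 (Nat.zero_le _)
  have key : ∑ j ∈ Finset.Icc 1 k, (s * (a j * s ^ α j) - t * (a j * t ^ α j)) ≤
      ∑ j ∈ Finset.Icc 1 k, (α k + 1) * (a j * s ^ α j) * (s - t) := by
    refine Finset.sum_le_sum fun j hj => ?_
    have haj := ha j (Finset.mem_Icc.1 hj).2
    have h1 := mul_le_mul_of_nonneg_left (rpow_add_one_sub_le ht hts (hα j hj)) haj.le
    have h2 : 0 ≤ a j * s ^ α j * (s - t) :=
      mul_nonneg (mul_nonneg haj.le (Real.rpow_nonneg (ht.trans hts) _)) (sub_nonneg.2 hts)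
    nlinarith [mul_le_mul_of_nonneg_right (hαk j hj) h2]
  rw [Finset.sum_sub_distrib, ← Finset.mul_sum, ← Finset.mul_sum, ← Finset.sum_mul,
    ← Finset.mul_sum] at key
  rw [hg, hg]
  have h3 : 0 ≤ α k * (a 0 * (s - t)) :=
    mul_nonneg h0.le (mul_nonneg ha0.le (sub_nonneg.2 hts))
  linarith

theorem exists_forchheimer_bounds {G Ginv K : ℝ → ℝ} {θ : ℝ} (ha : ∀ j ≤ k, 0 < a j)
    (hα : ∀ j ∈ Finset.Icc 1 k, 0 < α j)
    (hαk : ∀ j ∈ Finset.Icc 1 k, α j ≤ α k) (hk : 1 ≤ k)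
    (hg : ∀ s, g s = a 0 + ∑ j ∈ Finset.Icc 1 k, a j * s ^ α j)
    (hG : ∀ s, G s = s * g s)
    (hGinv : ∀ ξ, 0 ≤ ξ → 0 ≤ Ginv ξ ∧ G (Ginv ξ) = ξ)
    (hK : ∀ ξ, K ξ = 1 / g (Ginv ξ)) (hθ : θ = α k / (α k + 1)) :
    ∃ b c C : ℝ, 0 < b ∧ b ≤ 1 ∧ 0 < c ∧ 0 ≤ C ∧
      (∀ p, 0 ≤ p → c * (1 + p) ^ (-θ) ≤ K p) ∧
      (∀ p, 0 ≤ p → K p * p ≤ C * (1 + p) ^ (1 - θ)) ∧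
      (∀ p q, 0 ≤ q → q ≤ p → K p ≤ K q) ∧
      (∀ p q, 0 ≤ q → q ≤ p → b * K p * (p - q) ≤ K p * p - K q * q) := by
  have h0 := hα k (Finset.mem_Icc.2 ⟨hk, le_rfl⟩)
  have ha0 := ha 0 (Nat.zero_le _)
  have hak := ha k le_rfl
  have hθ0 : 0 < θ := by rw [hθ]; positivity
  have hθ' : 1 - θ = 1 / (α k + 1) := by rw [hθ]; field_simp; ring
  have hαθ : (α k + 1) * θ = α k := by rw [hθ]; field_simp
  have hgpos : ∀ s, 0 ≤ s → 0 < g s := fun s hs =>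
    lt_of_lt_of_le (by have := Real.rpow_nonneg hs (α k); positivity) (le_genPoly ha hk hg hs)
  have hKmul : ∀ p, 0 ≤ p → K p * p = Ginv p := by
    intro p hp
    obtain ⟨h1, h2⟩ := hGinv p hp
    have h3 := hgpos _ h1
    rw [hG] at h2
    rw [hK]
    nth_rewrite 2 [← h2]
    field_simp
  have hmono : ∀ p q, 0 ≤ q → q ≤ p → Ginv q ≤ Ginv p := by
    intro p q hq hqp
    obtain ⟨hs, hsG⟩ := hGinv p (hq.trans hqp)
    obtain ⟨ht, htG⟩ := hGinv q hq
    by_contra! hlt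
    have h1 : G (Ginv p) < G (Ginv q) := by
      rw [hG, hG]
      exact mul_lt_mul hlt (genPoly_mono ha hα hg hs hlt.le) (hgpos _ hs) ht
    linarith
  have hS : 0 < a 0 + ∑ j ∈ Finset.Icc 1 k, a j :=
    add_pos_of_pos_of_nonneg ha0
      (Finset.sum_nonneg fun j hj => (ha j (Finset.mem_Icc.1 hj).2).le)
  set S := a 0 + ∑ j ∈ Finset.Icc 1 k, a j
  have hm : 0 < min 1 (a k) := lt_min one_pos hak
  refine ⟨1 / (α k + 1), (min 1 (a k)) ^ θ / S, (1 / a k) ^ (1 - θ), by positivity, ?_,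
    by positivity, by positivity, ?_, ?_, ?_, ?_⟩
  · rw [div_le_one (by positivity)]; linarith
  · intro p hp
    obtain ⟨hs, hsG⟩ := hGinv p hp
    set s := Ginv p with hs_def
    have hM : 0 < max 1 s := lt_max_of_lt_left one_pos
    have h1 : min 1 (a k) * (max 1 s) ^ (α k + 1) ≤ 1 + p := by
      rcases le_total s 1 with h | h
      · rw [max_eq_left h, Real.one_rpow, mul_one]
        exact (min_le_left _ _).trans (by linarith)
      · rw [max_eq_right h]
        have h2 : a k * s ^ (α k + 1) ≤ p := by
          rw [← hsG, hG, Real.rpow_add_one' hs (by linarith)]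
          nlinarith [mul_le_mul_of_nonneg_left (le_genPoly ha hk hg hs) hs, mul_nonneg hs ha0.le]
        have h3 := mul_le_mul_of_nonneg_right (min_le_right 1 (a k))
          (Real.rpow_nonneg hs (α k + 1))
        linarith
    have h2 : (min 1 (a k)) ^ θ * (max 1 s) ^ α k ≤ (1 + p) ^ θ := by
      have := Real.rpow_le_rpow (by positivity) h1 hθ0.le
      rwa [Real.mul_rpow hm.le (by positivity), ← Real.rpow_mul hM.le, hαθ] at this
    have h3 : (max 1 s) ^ α k ≤ (1 + p) ^ θ / (min 1 (a k)) ^ θ := by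
      rw [le_div_iff₀ (by positivity)]; linarith
    have h4 : g s ≤ S * ((1 + p) ^ θ / (min 1 (a k)) ^ θ) :=
      (genPoly_le ha hα hαk hk hg hs).trans (mul_le_mul_of_nonneg_left h3 hS.le)
    have hp1 : 0 < 1 + p := by linarith
    rw [hK, ← hs_def, Real.rpow_neg hp1.le]
    refine le_trans (le_of_eq ?_) (one_div_le_one_div_of_le (hgpos s hs) h4)
    field_simp
  · intro p hp
    obtain ⟨hs, hsG⟩ := hGinv p hp
    rw [hKmul p hp]
    set s := Ginv p
    have h2 : s ^ (α k + 1) ≤ 1 / a k * (1 + p) := by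
      have h2 : a k * s ^ (α k + 1) ≤ p := by
        rw [← hsG, hG, Real.rpow_add_one' hs (by linarith)]
        nlinarith [mul_le_mul_of_nonneg_left (le_genPoly ha hk hg hs) hs, mul_nonneg hs ha0.le]
      rw [one_div_mul_eq_div, le_div_iff₀ hak]
      linarith
    have h3 := Real.rpow_le_rpow (by positivity) h2 (z := 1 - θ)
      (by rw [hθ']; positivity)
    rw [← Real.rpow_mul hs, Real.mul_rpow (by positivity) (by linarith)] at h3
    have h4 : (α k + 1) * (1 - θ) = 1 := by linarith
    rwa [h4, Real.rpow_one] at h3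
  · intro p q hq hqp
    rw [hK, hK]
    exact one_div_le_one_div_of_le (hgpos _ (hGinv q hq).1)
      (genPoly_mono ha hα hg (hGinv q hq).1 (hmono p q hq hqp))
  · intro p q hq hqp
    have hp := hq.trans hqp
    rw [hKmul p hp, hKmul q hq]
    obtain ⟨hs, hsG⟩ := hGinv p hp
    obtain ⟨ht, htG⟩ := hGinv q hq
    have h1 := mul_genPoly_sub_le ha hα hαk hk hg ht (hmono p q hq hqp)
    rw [← hG, ← hG, hsG, htG] at h1
    have h2 := hgpos _ hs
    rw [hK, show 1 / (α k + 1) * (1 / g (Ginv p)) * (p - q) =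
      (p - q) / ((α k + 1) * g (Ginv p)) by field_simp, div_le_iff₀ (by positivity)]
    linarith

end GeneralizedPolynomial

theorem integral_rpow_mul_rpow_le {X : Type*} [MeasurableSpace X] {μ : Measure X} {t : ℝ}
    (ht0 : 0 < t) (ht1 : t < 1) {f h : X → ℝ} (hf0 : ∀ x, 0 ≤ f x) (hh0 : ∀ x, 0 ≤ h x)
    (hf : Integrable f μ) (hh : Integrable h μ) :
    ∫ x, f x ^ t * h x ^ (1 - t) ∂μ ≤ (∫ x, f x ∂μ) ^ t * (∫ x, h x ∂μ) ^ (1 - t) := by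
  have memLp : ∀ {s : ℝ} {φ : X → ℝ}, 0 < s → (∀ x, 0 ≤ φ x) → Integrable φ μ →
      MemLp (fun x => φ x ^ s) (ENNReal.ofReal (1 / s)) μ := by
    intro s φ hs hφ0 hφ
    have hs' : 0 < 1 / s := by positivity
    refine (integrable_norm_rpow_iff ?_ (by simpa using hs) ENNReal.ofReal_ne_top).1 ?_
    · exact (hφ.aemeasurable.pow_const s).aestronglyMeasurable
    · refine hφ.congr (Filter.Eventually.of_forall fun x => ?_)
      simp only
      rw [ENNReal.toReal_ofReal hs'.le, Real.norm_of_nonneg (Real.rpow_nonneg (hφ0 x) _),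
        ← Real.rpow_mul (hφ0 x), mul_one_div_cancel hs.ne', Real.rpow_one]
  have ht1' : 0 < 1 - t := by linarith
  have hpq : (1 / t).HolderConjugate (1 / (1 - t)) := by
    rw [one_div, one_div]
    exact Real.HolderConjugate.inv_inv ht0 ht1' (by ring)
  have key := integral_mul_le_Lp_mul_Lq_of_nonneg hpq
    (Filter.Eventually.of_forall fun x => Real.rpow_nonneg (hf0 x) t)
    (Filter.Eventually.of_forall fun x => Real.rpow_nonneg (hh0 x) (1 - t))
    (memLp ht0 hf0 hf) (memLp ht1' hh0 hh)
  simpa only [← Real.rpow_mul (hf0 _), ← Real.rpow_mul (hh0 _), mul_one_div_cancel ht0.ne',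
    mul_one_div_cancel ht1'.ne', Real.rpow_one, one_div_one_div] using key

theorem one_add_add_rpow_le {p q e : ℝ} (hp : 0 ≤ p) (hq : 0 ≤ q) (he : 0 ≤ e) :
    (1 + p + q) ^ e ≤ 3 ^ e * (1 + p ^ e + q ^ e) := by
  have hpe := Real.rpow_nonneg hp e
  have hqe := Real.rpow_nonneg hq e
  have key : ∀ m, 0 ≤ m → 1 + p + q ≤ 3 * m → m ^ e ≤ 1 + p ^ e + q ^ e →
      (1 + p + q) ^ e ≤ 3 ^ e * (1 + p ^ e + q ^ e) := fun m hm h1 h2 => by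
    refine (Real.rpow_le_rpow (by positivity) h1 he).trans ?_
    rw [Real.mul_rpow (by norm_num) hm]
    gcongr
  rcases le_total p q with h | h
  · rcases le_total 1 q with h1 | h1
    · exact key q hq (by linarith) (by linarith)
    · exact key 1 zero_le_one (by linarith) (by rw [Real.one_rpow]; linarith)
  · rcases le_total 1 p with h1 | h1
    · exact key p hp (by linarith) (by linarith)
    · exact key 1 zero_le_one (by linarith) (by rw [Real.one_rpow]; linarith)

section Integral

variable {X E : Type*} [MeasurableSpace X] [NormedAddCommGroup E] [InnerProductSpace ℝ E]
  {K : ℝ → ℝ} {θ b c C : ℝ}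

theorem le_inner_forchheimer (hb0 : 0 < b) (hb1 : b ≤ 1) (hc : 0 < c) (hθ0 : 0 < θ)
    (hK1 : ∀ p, 0 ≤ p → c * (1 + p) ^ (-θ) ≤ K p)
    (hK3 : ∀ p q, 0 ≤ q → q ≤ p → K p ≤ K q)
    (hK4 : ∀ p q, 0 ≤ q → q ≤ p → b * K p * (p - q) ≤ K p * p - K q * q) (y z : E) :
    b * c * ((1 + ‖y‖ + ‖z‖) ^ (-θ) * ‖y - z‖ ^ 2) ≤
      ⟪K ‖y‖ • y - K ‖z‖ • z, y - z⟫ := by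
  wlog h : ‖z‖ ≤ ‖y‖ generalizing y z
  · have h1 := this z y (le_of_not_ge h)
    rwa [norm_sub_rev z y, add_right_comm, ← neg_sub (K ‖y‖ • y), ← neg_sub y z,
      inner_neg_neg] at h1
  have hKlow := hK1 ‖y‖ (norm_nonneg y)
  have hKpos : 0 ≤ K ‖y‖ :=
    (mul_nonneg hc.le (Real.rpow_nonneg (by positivity) _)).trans hKlow
  refine le_trans ?_ (le_inner_smul_sub_smul hKpos (hK3 _ _ (norm_nonneg z) h) hb1 h
    (hK4 _ _ (norm_nonneg z) h))
  have h1 : (1 + ‖y‖ + ‖z‖) ^ (-θ) ≤ (1 + ‖y‖) ^ (-θ) :=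
    Real.rpow_le_rpow_of_nonpos (by positivity) (by linarith [norm_nonneg z]) (by linarith)
  rw [← mul_assoc, mul_assoc b]
  gcongr
  exact le_trans (by gcongr) hKlow

theorem norm_inner_forchheimer_le (hC : 0 ≤ C) (hθ1 : θ < 1)
    (hK0 : ∀ p, 0 ≤ p → 0 ≤ K p)
    (hK2 : ∀ p, 0 ≤ p → K p * p ≤ C * (1 + p) ^ (1 - θ)) (y z : E) :
    ‖⟪K ‖y‖ • y - K ‖z‖ • z, y - z⟫‖ ≤ 2 * C * (1 + ‖y‖ + ‖z‖) ^ (2 - θ) := by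
  have hy := norm_nonneg y
  have hz := norm_nonneg z
  have hw : 0 < 1 + ‖y‖ + ‖z‖ := by positivity
  have bound : ∀ p, 0 ≤ p → p ≤ ‖y‖ + ‖z‖ → K p * p ≤ C * (1 + ‖y‖ + ‖z‖) ^ (1 - θ) := by
    intro p hp hpw
    refine (hK2 p hp).trans (mul_le_mul_of_nonneg_left ?_ hC)
    exact Real.rpow_le_rpow (by linarith) (by linarith) (by linarith)
  have h1 : ‖K ‖y‖ • y - K ‖z‖ • z‖ ≤ 2 * C * (1 + ‖y‖ + ‖z‖) ^ (1 - θ) := by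
    refine (norm_sub_le _ _).trans ?_
    rw [norm_smul, norm_smul, Real.norm_of_nonneg (hK0 _ hy), Real.norm_of_nonneg (hK0 _ hz)]
    linarith [bound _ hy (by linarith), bound _ hz (by linarith)]
  have h2 : ‖y - z‖ ≤ 1 + ‖y‖ + ‖z‖ := (norm_sub_le _ _).trans (by linarith)
  have h3 : (1 + ‖y‖ + ‖z‖) ^ (2 - θ) =
      (1 + ‖y‖ + ‖z‖) ^ (1 - θ) * (1 + ‖y‖ + ‖z‖) := by
    rw [show 2 - θ = 1 - θ + 1 by ring, Real.rpow_add_one hw.ne']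
  rw [h3, ← mul_assoc]
  exact (norm_inner_le_norm _ _).trans
    (mul_le_mul h1 h2 (norm_nonneg _) ((norm_nonneg _).trans h1))

theorem aestronglyMeasurable_smul_of_antitone {μ : Measure X}
    (hK3 : ∀ p q, 0 ≤ q → q ≤ p → K p ≤ K q) {v : X → E} (hv : AEStronglyMeasurable v μ) :
    AEStronglyMeasurable (fun x => K ‖v x‖ • v x) μ := by
  have hanti : Antitone fun s => K (max s 0) := fun s t hst =>
    hK3 _ _ (le_max_right _ _) (max_le_max_right 0 hst)
  have h := (hanti.measurable.comp_aemeasurable hv.norm.aemeasurable).aestronglyMeasurable.smul hv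
  refine h.congr (Filter.Eventually.of_forall fun x => ?_)
  simp

theorem exists_integral_inner_forchheimer_ge {μ : Measure X} [IsFiniteMeasure μ]
    (hb0 : 0 < b) (hb1 : b ≤ 1) (hc : 0 < c) (hC : 0 ≤ C) (hθ0 : 0 < θ) (hθ1 : θ < 1)
    (hK1 : ∀ p, 0 ≤ p → c * (1 + p) ^ (-θ) ≤ K p)
    (hK2 : ∀ p, 0 ≤ p → K p * p ≤ C * (1 + p) ^ (1 - θ))
    (hK3 : ∀ p q, 0 ≤ q → q ≤ p → K p ≤ K q)
    (hK4 : ∀ p q, 0 ≤ q → q ≤ p → b * K p * (p - q) ≤ K p * p - K q * q) :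
    ∃ L : ℝ, 1 ≤ L ∧ ∀ v₁ v₂ : X → E,
      AEStronglyMeasurable v₁ μ → AEStronglyMeasurable v₂ μ →
      Integrable (fun x => ‖v₁ x‖ ^ (2 - θ)) μ → Integrable (fun x => ‖v₂ x‖ ^ (2 - θ)) μ →
      (L * (1 + max ((∫ x, ‖v₁ x‖ ^ (2 - θ) ∂μ) ^ (1 / (2 - θ)))
                    ((∫ x, ‖v₂ x‖ ^ (2 - θ) ∂μ) ^ (1 / (2 - θ)))) ^ θ)⁻¹ *
        (∫ x, ‖v₁ x - v₂ x‖ ^ (2 - θ) ∂μ) ^ ((2 : ℝ) / (2 - θ)) ≤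
      ∫ x, ⟪K ‖v₁ x‖ • v₁ x - K ‖v₂ x‖ • v₂ x, v₁ x - v₂ x⟫ ∂μ := by
  have he : 0 < 2 - θ := by linarith
  have hK0 : ∀ p, 0 ≤ p → 0 ≤ K p := fun p hp =>
    (mul_nonneg hc.le (Real.rpow_nonneg (by linarith) _)).trans (hK1 p hp)
  set B : ℝ := 3 ^ (2 - θ) * (μ.real univ + 2)
  have hB : 0 < B := by positivity
  refine ⟨max 1 (B ^ (θ / (2 - θ)) / (b * c)), le_max_left _ _, fun v₁ v₂ hv₁ hv₂ hi₁ hi₂ => ?_⟩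
  set L := max 1 (B ^ (θ / (2 - θ)) / (b * c))
  have hL : 0 < L := lt_max_of_lt_left one_pos
  set P := ∫ x, ‖v₁ x‖ ^ (2 - θ) ∂μ
  set Q := ∫ x, ‖v₂ x‖ ^ (2 - θ) ∂μ
  have hP : 0 ≤ P := integral_nonneg fun x => Real.rpow_nonneg (norm_nonneg _) _
  have hQ : 0 ≤ Q := integral_nonneg fun x => Real.rpow_nonneg (norm_nonneg _) _
  set M := max (P ^ (1 / (2 - θ))) (Q ^ (1 / (2 - θ)))
  have hM : 0 ≤ M := le_max_of_le_left (Real.rpow_nonneg hP _)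
  set w : X → ℝ := fun x => 1 + ‖v₁ x‖ + ‖v₂ x‖
  have hw : ∀ x, 0 < w x := fun x => by positivity
  have hw_meas : AEStronglyMeasurable w μ :=
    (aestronglyMeasurable_const.add hv₁.norm).add hv₂.norm
  have hmaj : Integrable (fun x => 3 ^ (2 - θ) * (1 + ‖v₁ x‖ ^ (2 - θ) + ‖v₂ x‖ ^ (2 - θ))) μ :=
    (((integrable_const 1).add hi₁).add hi₂).const_mul _
  have hwle : ∀ x, w x ^ (2 - θ) ≤ 3 ^ (2 - θ) * (1 + ‖v₁ x‖ ^ (2 - θ) + ‖v₂ x‖ ^ (2 - θ)) :=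
    fun x => one_add_add_rpow_le (norm_nonneg _) (norm_nonneg _) he.le
  have hw_int : Integrable (fun x => w x ^ (2 - θ)) μ := by
    refine hmaj.mono' (hw_meas.aemeasurable.pow_const _).aestronglyMeasurable
      (Filter.Eventually.of_forall fun x => ?_)
    rw [Real.norm_of_nonneg (Real.rpow_nonneg (hw x).le _)]
    exact hwle x
  have hW0 : 0 ≤ ∫ x, w x ^ (2 - θ) ∂μ :=
    integral_nonneg fun x => Real.rpow_nonneg (hw x).le _
  have hW : ∫ x, w x ^ (2 - θ) ∂μ ≤ B * (1 + M) ^ (2 - θ) := by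
    have h1 : ∫ x, w x ^ (2 - θ) ∂μ ≤ 3 ^ (2 - θ) * (μ.real univ + P + Q) := by
      refine (integral_mono hw_int hmaj hwle).trans_eq ?_
      have hi : Integrable (fun x => 1 + ‖v₁ x‖ ^ (2 - θ)) μ := (integrable_const 1).add hi₁
      rw [integral_const_mul, integral_add hi hi₂,
        integral_add (integrable_const 1) hi₁, integral_const, smul_eq_mul, mul_one]
    have pow_le : ∀ {R : ℝ}, 0 ≤ R → R ^ (1 / (2 - θ)) ≤ M → R ≤ (1 + M) ^ (2 - θ) := by
      intro R hR hRM
      calc R = (R ^ (1 / (2 - θ))) ^ (2 - θ) := by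
            rw [← Real.rpow_mul hR, one_div_mul_cancel he.ne', Real.rpow_one]
        _ ≤ (1 + M) ^ (2 - θ) :=
            Real.rpow_le_rpow (Real.rpow_nonneg hR _) (by linarith) he.le
    have h2 := pow_le hP (le_max_left _ _)
    have h3 := pow_le hQ (le_max_right _ _)
    have h4 : 1 ≤ (1 + M) ^ (2 - θ) := Real.one_le_rpow (by linarith) he.le
    have h5 : μ.real univ ≤ μ.real univ * (1 + M) ^ (2 - θ) :=
      le_mul_of_one_le_right measureReal_nonneg h4
    refine h1.trans ?_
    rw [mul_assoc]
    refine mul_le_mul_of_nonneg_left ?_ (by positivity)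
    linarith
  set f : X → ℝ := fun x => w x ^ (-θ) * ‖v₁ x - v₂ x‖ ^ 2
  have hf0 : ∀ x, 0 ≤ f x := fun x => mul_nonneg (Real.rpow_nonneg (hw x).le _) (by positivity)
  have hf_int : Integrable f μ := by
    refine hw_int.mono' ((hw_meas.aemeasurable.pow_const _).aestronglyMeasurable.mul
      ((hv₁.sub hv₂).norm.pow 2)) (Filter.Eventually.of_forall fun x => ?_)
    rw [Real.norm_of_nonneg (hf0 x), show 2 - θ = -θ + (2 : ℕ) by push_cast; ring,
      Real.rpow_add_natCast (hw x).ne']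
    refine mul_le_mul_of_nonneg_left ?_ (Real.rpow_nonneg (hw x).le _)
    exact pow_le_pow_left₀ (norm_nonneg _) ((norm_sub_le _ _).trans (by simp only [w]; linarith)) 2
  have hF_int : Integrable
      (fun x => ⟪K ‖v₁ x‖ • v₁ x - K ‖v₂ x‖ • v₂ x, v₁ x - v₂ x⟫) μ := by
    refine (hw_int.const_mul (2 * C)).mono' (((aestronglyMeasurable_smul_of_antitone hK3 hv₁).sub
      (aestronglyMeasurable_smul_of_antitone hK3 hv₂)).inner (hv₁.sub hv₂))
      (Filter.Eventually.of_forall fun x => norm_inner_forchheimer_le hC hθ1 hK0 hK2 _ _)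
  have hlow : b * c * ∫ x, f x ∂μ ≤
      ∫ x, ⟪K ‖v₁ x‖ • v₁ x - K ‖v₂ x‖ • v₂ x, v₁ x - v₂ x⟫ ∂μ := by
    rw [← integral_const_mul]
    exact integral_mono (hf_int.const_mul _) hF_int fun x =>
      le_inner_forchheimer hb0 hb1 hc hθ0 hK1 hK3 hK4 _ _
  have hX0 : 0 ≤ ∫ x, f x ∂μ := integral_nonneg hf0
  have hI : ∫ x, ‖v₁ x - v₂ x‖ ^ (2 - θ) ∂μ ≤
      (∫ x, f x ∂μ) ^ ((2 - θ) / 2) * (∫ x, w x ^ (2 - θ) ∂μ) ^ (1 - (2 - θ) / 2) := by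
    refine le_trans (le_of_eq (integral_congr_ae (Filter.Eventually.of_forall fun x => ?_)))
      (integral_rpow_mul_rpow_le (by linarith) (by linarith) hf0
        (fun x => Real.rpow_nonneg (hw x).le _) hf_int hw_int)
    simp only [f]
    rw [Real.mul_rpow (Real.rpow_nonneg (hw x).le _) (by positivity), ← Real.rpow_mul (hw x).le,
      ← Real.rpow_mul (hw x).le, ← Real.rpow_natCast_mul (norm_nonneg _), mul_right_comm,
      ← Real.rpow_add (hw x)]
    rw [show -θ * ((2 - θ) / 2) + (2 - θ) * (1 - (2 - θ) / 2) = 0 by ring, Real.rpow_zero, one_mul]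
    congr 1
    push_cast
    ring
  have hI' : (∫ x, ‖v₁ x - v₂ x‖ ^ (2 - θ) ∂μ) ^ ((2 : ℝ) / (2 - θ)) ≤
      (∫ x, f x ∂μ) * (B ^ (θ / (2 - θ)) * (1 + M) ^ θ) := by
    have h1 := Real.rpow_le_rpow
      (integral_nonneg fun x => Real.rpow_nonneg (norm_nonneg (v₁ x - v₂ x)) (2 - θ)) hI
      (z := 2 / (2 - θ)) (by positivity)
    rw [Real.mul_rpow (Real.rpow_nonneg hX0 _) (Real.rpow_nonneg hW0 _), ← Real.rpow_mul hX0,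
      ← Real.rpow_mul hW0, show (2 - θ) / 2 * (2 / (2 - θ)) = 1 by field_simp, Real.rpow_one,
      show (1 - (2 - θ) / 2) * (2 / (2 - θ)) = θ / (2 - θ) by field_simp; ring] at h1
    refine h1.trans (mul_le_mul_of_nonneg_left ?_ hX0)
    have h2 := Real.rpow_le_rpow hW0 hW (z := θ / (2 - θ)) (by positivity)
    rwa [Real.mul_rpow hB.le (by positivity), ← Real.rpow_mul (by positivity),
      mul_div_cancel₀ _ he.ne'] at h2
  have hLB : B ^ (θ / (2 - θ)) ≤ L * (b * c) :=
    (div_le_iff₀ (by positivity)).1 (le_max_right _ _)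
  have hMθ : 0 < (1 + M) ^ θ := Real.rpow_pos_of_pos (by linarith) _
  refine le_trans ?_ hlow
  rw [inv_mul_le_iff₀ (by positivity)]
  refine hI'.trans ?_
  have := mul_le_mul_of_nonneg_left (mul_le_mul_of_nonneg_right hLB hMθ.le) hX0
  linarith

end Integral

theorem ContDiffOn.continuousOn_gradient {F : Type*} [NormedAddCommGroup F]
    [InnerProductSpace ℝ F] [CompleteSpace F] {u : F → ℝ} {U : Set F}
    (hu : ContDiffOn ℝ 1 u U) (hU : IsOpen U) : ContinuousOn (gradient u) U :=
  (InnerProductSpace.toDual ℝ F).symm.continuous.comp_continuousOn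
    (hu.continuousOn_fderiv_of_isOpen hU le_rfl)

theorem gradient_sub_apply {F : Type*} [NormedAddCommGroup F]
    [InnerProductSpace ℝ F] [CompleteSpace F] {u v : F → ℝ} {x : F}
    (hu : DifferentiableAt ℝ u x) (hv : DifferentiableAt ℝ v x) :
    gradient (u - v) x = gradient u x - gradient v x := by
  simp only [gradient, fderiv_sub hu hv, map_sub]

/-- Monotonicity inequality for the Forchheimer vector field:
for a bounded open `U ⊆ ℝⁿ` there is a constant `C ≥ 1` such that for all
`C¹` functions `u₁, u₂` with `∇u₁, ∇u₂ ∈ L^{2-a}(U)`,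
`∫_U (K(|∇u₁|)∇u₁ - K(|∇u₂|)∇u₂) · ∇(u₁-u₂) dx
  ≥ C_Φ⁻¹ (∫_U |∇(u₁-u₂)|^{2-a} dx)^{2/(2-a)}`,
where `C_Φ = C (1 + max(‖∇u₁‖_{L^{2-a}}, ‖∇u₂‖_{L^{2-a}}))^a`. -/
theorem stmt_7
    (n : ℕ) (hn : 2 ≤ n)
    (U : Set (EuclideanSpace ℝ (Fin n))) (hUo : IsOpen U)
    (hUb : Bornology.IsBounded U)
    (k : ℕ) (hk : 1 ≤ k) (a α : ℕ → ℝ)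
    (ha : ∀ j ≤ k, 0 < a j)
    (hα1 : 0 < α 1)
    (hαmono : ∀ i j : ℕ, 1 ≤ i → i < j → j ≤ k → α i < α j)
    (g G Ginv K : ℝ → ℝ)
    (hg : ∀ s : ℝ, g s = a 0 + ∑ j ∈ Finset.Icc 1 k, a j * s ^ (α j))
    (hG : ∀ s : ℝ, G s = s * g s)
    (hGinv1 : ∀ s : ℝ, 0 ≤ s → Ginv (G s) = s)
    (hGinv2 : ∀ ξ : ℝ, 0 ≤ ξ → 0 ≤ Ginv ξ ∧ G (Ginv ξ) = ξ)
    (hK : ∀ ξ : ℝ, K ξ = 1 / g (Ginv ξ))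
    (aa : ℝ) (haa : aa = α k / (α k + 1)) :
    ∃ C : ℝ, 1 ≤ C ∧
      ∀ u₁ u₂ : EuclideanSpace ℝ (Fin n) → ℝ,
        ContDiffOn ℝ 1 u₁ U → ContDiffOn ℝ 1 u₂ U →
        IntegrableOn (fun x => ‖gradient u₁ x‖ ^ (2 - aa)) U →
        IntegrableOn (fun x => ‖gradient u₂ x‖ ^ (2 - aa)) U →
        (∫ x in U, ⟪K ‖gradient u₁ x‖ • gradient u₁ x -
            K ‖gradient u₂ x‖ • gradient u₂ x, gradient (u₁ - u₂) x⟫) ≥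
          (C * (1 + max ((∫ x in U, ‖gradient u₁ x‖ ^ (2 - aa)) ^ (1 / (2 - aa)))
                        ((∫ x in U, ‖gradient u₂ x‖ ^ (2 - aa)) ^ (1 / (2 - aa)))) ^ aa)⁻¹ *
            (∫ x in U, ‖gradient (u₁ - u₂) x‖ ^ (2 - aa)) ^ ((2:ℝ) / (2 - aa)) := by
  have hα : ∀ j ∈ Finset.Icc 1 k, 0 < α j := fun j hj => by
    obtain ⟨h1, h2⟩ := Finset.mem_Icc.1 hj
    rcases h1.eq_or_lt with rfl | h
    · exact hα1
    · exact hα1.trans (hαmono 1 j le_rfl h h2)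
  have hαk : ∀ j ∈ Finset.Icc 1 k, α j ≤ α k := fun j hj => by
    obtain ⟨h1, h2⟩ := Finset.mem_Icc.1 hj
    rcases h2.eq_or_lt with rfl | h
    · exact le_rfl
    · exact (hαmono j k h1 h le_rfl).le
  have hαk0 : 0 < α k := hα k (Finset.mem_Icc.2 ⟨hk, le_rfl⟩)
  have haa0 : 0 < aa := by rw [haa]; positivity
  have haa1 : aa < 1 := by rw [haa, div_lt_one (by positivity)]; linarith
  obtain ⟨b, c, C, hb0, hb1, hc, hC, hK1, hK2, hK3, hK4⟩ :=
    exists_forchheimer_bounds ha hα hαk hk hg hG hGinv2 hK haa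
  have : IsFiniteMeasure (volume.restrict U) :=
    isFiniteMeasure_restrict.2 hUb.measure_lt_top.ne
  obtain ⟨L, hL, key⟩ := exists_integral_inner_forchheimer_ge (E := EuclideanSpace ℝ (Fin n))
    (μ := volume.restrict U) hb0 hb1 hc hC haa0 haa1 hK1 hK2 hK3 hK4
  refine ⟨L, hL, fun u₁ u₂ hu₁ hu₂ hi₁ hi₂ => ?_⟩
  have hsub : ∀ x ∈ U, gradient (u₁ - u₂) x = gradient u₁ x - gradient u₂ x := fun x hx =>
    gradient_sub_apply ((hu₁.differentiableOn one_ne_zero).differentiableAt (hUo.mem_nhds hx))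
      ((hu₂.differentiableOn one_ne_zero).differentiableAt (hUo.mem_nhds hx))
  have h := key (gradient u₁) (gradient u₂)
    ((hu₁.continuousOn_gradient hUo).aestronglyMeasurable hUo.measurableSet)
    ((hu₂.continuousOn_gradient hUo).aestronglyMeasurable hUo.measurableSet) hi₁ hi₂
  have hnorm : ∫ x in U, ‖gradient (u₁ - u₂) x‖ ^ (2 - aa) =
      ∫ x in U, ‖gradient u₁ x - gradient u₂ x‖ ^ (2 - aa) :=
    setIntegral_congr_fun hUo.measurableSet fun x hx => by simp only [hsub x hx]
  have hinner : ∫ x in U, ⟪K ‖gradient u₁ x‖ • gradient u₁ x -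
        K ‖gradient u₂ x‖ • gradient u₂ x, gradient (u₁ - u₂) x⟫ =
      ∫ x in U, ⟪K ‖gradient u₁ x‖ • gradient u₁ x -
        K ‖gradient u₂ x‖ • gradient u₂ x, gradient u₁ x - gradient u₂ x⟫ :=
    setIntegral_congr_fun hUo.measurableSet fun x hx => by simp only [hsub x hx]
  rw [ge_iff_le, hnorm, hinner]
  exact h
end

section
/- Let φ : [0,∞) → [0,∞) be a continuous, strictly increasing function with φ(0) = 0 that maps [0,∞) onto [0,∞), and let φ⁻¹ denote its inverse. Let C > 0 and let f : [0,∞) → [0,∞) be a continuous bounded function. Suppose y : [0,∞) → [0,∞) is a differentiable function satisfying y'(t) ≤ −C·φ⁻¹(y(t)) + f(t) for all t > 0. Then limsup_{t→∞} y(t) ≤ φ( (limsup_{t→∞} f(t)) / C ). -/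
open Set Filter

/-- Gronwall-type asymptotic lemma. If `φ : [0,∞) → [0,∞)` is a
continuous strictly increasing bijection with `φ(0) = 0` and inverse `φ⁻¹`,
`C > 0`, `f : [0,∞) → [0,∞)` is continuous and bounded, and `y ≥ 0` is
differentiable with `y'(t) ≤ -C·φ⁻¹(y(t)) + f(t)` for `t > 0`, then
`limsup_{t→∞} y(t) ≤ φ((limsup_{t→∞} f(t))/C)`. -/
theorem stmt_10
    (φ φinv : ℝ → ℝ)
    (hφc : ContinuousOn φ (Ici 0))
    (hφm : StrictMonoOn φ (Ici 0))
    (hφ0 : φ 0 = 0)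
    (hφmaps : MapsTo φ (Ici 0) (Ici 0))
    (hφsurj : SurjOn φ (Ici 0) (Ici 0))
    (hinv1 : ∀ s ∈ Ici (0:ℝ), φinv (φ s) = s)
    (hinv2 : ∀ t ∈ Ici (0:ℝ), φinv t ∈ Ici (0:ℝ) ∧ φ (φinv t) = t)
    (C : ℝ) (hC : 0 < C)
    (f : ℝ → ℝ)
    (hfc : ContinuousOn f (Ici 0))
    (hf0 : ∀ t ∈ Ici (0:ℝ), 0 ≤ f t)
    (hfb : ∃ M : ℝ, ∀ t ∈ Ici (0:ℝ), f t ≤ M)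
    (y : ℝ → ℝ)
    (hy0 : ∀ t ∈ Ici (0:ℝ), 0 ≤ y t)
    (hyd : ∀ t ∈ Ici (0:ℝ), DifferentiableAt ℝ y t)
    (hode : ∀ t : ℝ, 0 < t → deriv y t ≤ -C * φinv (y t) + f t) :
    limsup y atTop ≤ φ (limsup f atTop / C) := by
  obtain ⟨M, hM⟩ := hfb
  have hfbdd : IsBoundedUnder (· ≤ ·) atTop f :=
    isBoundedUnder_of_eventually_le ((eventually_ge_atTop 0).mono hM)
  have hL : 0 ≤ limsup f atTop :=
    le_limsup_of_frequently_le ((eventually_ge_atTop 0).mono hf0).frequently hfbdd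
  have hs : limsup f atTop / C ∈ Ici (0:ℝ) := div_nonneg hL hC.le
  refine le_of_forall_gt_imp_ge_of_dense fun a ha => ?_
  have ha0 : a ∈ Ici (0:ℝ) := (hφmaps hs).trans ha.le
  obtain ⟨hb0, hb⟩ := hinv2 a ha0
  have hsb : limsup f atTop / C < φinv a := by
    rw [← hb] at ha
    exact (hφm.lt_iff_lt hs hb0).1 ha
  have hLb : limsup f atTop < C * φinv a := by
    rwa [div_lt_iff₀' hC] at hsb
  obtain ⟨m, hLm, hmb⟩ := exists_between hLb
  obtain ⟨T, hT⟩ := eventually_atTop.1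
    ((eventually_lt_of_limsup_lt hLm hfbdd).and (eventually_gt_atTop 0))
  have hTpos : 0 < T := (hT T le_rfl).2
  have hdecay : ∀ t, T ≤ t → a ≤ y t → deriv y t ≤ m - C * φinv a := by
    intro t ht hat
    obtain ⟨hft, ht0⟩ := hT t ht
    obtain ⟨hyi0, hyi⟩ := hinv2 (y t) (hy0 t ht0.le)
    have hle : φinv a ≤ φinv (y t) := by
      rw [← hb, ← hyi] at hat
      exact (hφm.le_iff_le hb0 hyi0).1 hat
    have := mul_le_mul_of_nonneg_left hle hC.le
    linarith [hode t ht0]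
  have hyd' : ∀ t, T ≤ t → DifferentiableAt ℝ y t := fun t ht => hyd t (hTpos.le.trans ht)
  have hhit : ∃ t, T ≤ t ∧ y t ≤ a := by
    by_contra! hgt
    have hδ : 0 < C * φinv a - m := sub_pos.2 hmb
    set u := T + (y T + 1) / (C * φinv a - m) with hu
    have hTu : T ≤ u :=
      le_add_of_nonneg_right (div_nonneg (by linarith [hy0 T hTpos.le]) hδ.le)
    have hdrop := (convex_Ici T).image_sub_le_mul_sub_of_deriv_le
      (fun t ht => (hyd' t ht).continuousAt.continuousWithinAt)
      (fun t ht => (hyd' t (interior_subset ht)).differentiableWithinAt)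
      (fun t ht => hdecay t (interior_subset ht) (hgt t (interior_subset ht)).le)
      T self_mem_Ici u hTu hTu
    have hmul : (m - C * φinv a) * (u - T) = -(y T + 1) := by
      rw [hu]
      field_simp
      ring
    linarith [hy0 u (hTpos.le.trans hTu)]
  obtain ⟨t₀, ht₀, hyt₀⟩ := hhit
  have hbound : ∀ t, t₀ ≤ t → y t ≤ a := by
    intro t ht
    exact image_le_of_deriv_right_lt_deriv_boundary (f := y) (f' := deriv y)
      (B := fun _ => a) (B' := fun _ => 0)
      (fun x hx => (hyd' x (ht₀.trans hx.1)).continuousAt.continuousWithinAt)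
      (fun x hx => (hyd' x (ht₀.trans hx.1)).hasDerivAt.hasDerivWithinAt)
      hyt₀ (fun x => hasDerivAt_const x a)
      (fun x hx hxa => (hdecay x (ht₀.trans hx.1) hxa.ge).trans_lt (sub_neg.2 hmb))
      (right_mem_Icc.2 ht)
  exact limsup_le_of_le
    (isCoboundedUnder_le_of_eventually_le atTop ((eventually_ge_atTop 0).mono hy0))
    ((eventually_ge_atTop t₀).mono hbound)
end

section
/- Let k > 0 and let f : [0,∞) → [0,∞) be a continuous bounded function. Then limsup_{t→∞} ∫_0^t e^{−k(t−τ)} f(τ) dτ ≤ k⁻¹ · limsup_{t→∞} f(t). -/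
open Set Filter

/-- Pointwise domination `f ≤ L + C e^{-kτ}` is inherited, after convolution with `e^{-kt}`,
by an explicit bound tending to `L / k`. -/
theorem integral_exp_mul_le_of_le_add_exp {k L C t : ℝ} (hk : 0 < k) {f : ℝ → ℝ}
    (hfc : ContinuousOn f (Ici 0)) (ht : 0 ≤ t)
    (hf : ∀ τ, 0 ≤ τ → f τ ≤ L + C * Real.exp (-k * τ)) :
    ∫ τ in (0 : ℝ)..t, Real.exp (-k * (t - τ)) * f τ ≤
      L / k * (1 - Real.exp (-k * t)) + C * (t * Real.exp (-k * t)) := by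
  have hderiv : ∀ τ ∈ uIcc 0 t,
      HasDerivAt (fun τ => L / k * Real.exp (-k * (t - τ)) + C * (τ * Real.exp (-k * t)))
        (L * Real.exp (-k * (t - τ)) + C * Real.exp (-k * t)) τ := by
    intro τ _
    have h1 : HasDerivAt (fun τ => -k * (t - τ)) k τ := by
      simpa using ((hasDerivAt_id τ).const_sub t).const_mul (-k)
    refine ((h1.exp.const_mul (L / k)).add
      (((hasDerivAt_id τ).mul_const (Real.exp (-k * t))).const_mul C)).congr_deriv ?_
    field_simp
  have hint : IntervalIntegrable
      (fun τ => L * Real.exp (-k * (t - τ)) + C * Real.exp (-k * t)) MeasureTheory.volume 0 t :=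
    Continuous.intervalIntegrable (by fun_prop) _ _
  have hle : ∫ τ in (0 : ℝ)..t, Real.exp (-k * (t - τ)) * f τ ≤
      ∫ τ in (0 : ℝ)..t, (L * Real.exp (-k * (t - τ)) + C * Real.exp (-k * t)) := by
    refine intervalIntegral.integral_mono_on ht ?_ hint ?_
    · refine ContinuousOn.intervalIntegrable_of_Icc ht (ContinuousOn.mul ?_ ?_)
      · exact Continuous.continuousOn (by fun_prop)
      · exact hfc.mono Icc_subset_Ici_self
    · intro τ hτ
      have hexp : Real.exp (-k * t) = Real.exp (-k * (t - τ)) * Real.exp (-k * τ) := by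
        rw [← Real.exp_add]
        ring_nf
      rw [hexp]
      nlinarith [mul_le_mul_of_nonneg_left (hf τ hτ.1) (Real.exp_pos (-k * (t - τ))).le]
  refine hle.trans_eq ?_
  rw [intervalIntegral.integral_eq_sub_of_hasDerivAt hderiv hint]
  simp
  ring

theorem tendsto_const_mul_one_sub_exp_add {k : ℝ} (hk : 0 < k) (a C : ℝ) :
    Tendsto (fun t => a * (1 - Real.exp (-k * t)) + C * (t * Real.exp (-k * t)))
      atTop (nhds a) := by
  have h1 : Tendsto (fun t : ℝ => Real.exp (-k * t)) atTop (nhds 0) :=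
    Real.tendsto_exp_atBot.comp (tendsto_id.const_mul_atTop_of_neg (neg_lt_zero.mpr hk))
  have h2 : Tendsto (fun t : ℝ => t * Real.exp (-k * t)) atTop (nhds 0) := by
    simpa using tendsto_rpow_mul_exp_neg_mul_atTop_nhds_zero 1 k hk
  simpa using ((h1.const_sub 1).const_mul a).add (h2.const_mul C)

/-- For `k > 0` and a continuous bounded `f : [0,∞) → [0,∞)`,
`limsup_{t→∞} ∫_0^t e^{-k(t-τ)} f(τ) dτ ≤ k⁻¹ · limsup_{t→∞} f(t)`. -/
theorem stmt_11
    (k : ℝ) (hk : 0 < k)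
    (f : ℝ → ℝ)
    (hfc : ContinuousOn f (Ici 0))
    (hf0 : ∀ t ∈ Ici (0:ℝ), 0 ≤ f t)
    (hfb : ∃ M : ℝ, ∀ t ∈ Ici (0:ℝ), f t ≤ M) :
    limsup (fun t : ℝ => ∫ τ in (0:ℝ)..t, Real.exp (-k * (t - τ)) * f τ) atTop ≤
      k⁻¹ * limsup f atTop := by
  obtain ⟨M, hM⟩ := hfb
  refine le_of_forall_gt_imp_ge_of_dense fun c hc => ?_
  have hL : limsup f atTop < k * c := by
    rwa [inv_mul_lt_iff₀ hk] at hc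
  have hbdd : IsBoundedUnder (· ≤ ·) atTop f :=
    isBoundedUnder_of_eventually_le ((eventually_ge_atTop 0).mono hM)
  obtain ⟨T, hT⟩ := eventually_atTop.mp (eventually_lt_of_limsup_lt hL hbdd)
  have hdom : ∀ τ, 0 ≤ τ →
      f τ ≤ k * c + |M - k * c| * Real.exp (k * T) * Real.exp (-k * τ) := by
    intro τ hτ
    rcases le_total T τ with h | h
    · have : 0 ≤ |M - k * c| * Real.exp (k * T) * Real.exp (-k * τ) := by positivity
      linarith [hT τ h]
    · have hexp : 1 ≤ Real.exp (k * T) * Real.exp (-k * τ) := by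
        rw [← Real.exp_add]
        exact Real.one_le_exp (by nlinarith)
      have := le_mul_of_one_le_right (abs_nonneg (M - k * c)) hexp
      rw [← mul_assoc] at this
      linarith [hM τ hτ, le_abs_self (M - k * c)]
  have hlim := tendsto_const_mul_one_sub_exp_add hk (k * c / k) (|M - k * c| * Real.exp (k * T))
  have hle := limsup_le_limsup
    ((eventually_ge_atTop 0).mono fun t ht => integral_exp_mul_le_of_le_add_exp hk hfc ht hdom)
    (isCoboundedUnder_le_of_eventually_le (x := 0) atTop
      ((eventually_ge_atTop 0).mono fun t ht => intervalIntegral.integral_nonneg ht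
        fun τ hτ => mul_nonneg (Real.exp_pos _).le (hf0 τ hτ.1)))
    hlim.isBoundedUnder_le
  rwa [hlim.limsup_eq, mul_div_cancel_left₀ c hk.ne'] at hle
end

section
/- Let U ⊂ ℝⁿ be a bounded measurable set, let a ∈ (0,1), let α > 2 with α ≥ n·a/(2−a), and set b = α(2−a)/2 and γ₀ = α/(α−a). Then for every ε > 0 there exists a constant C_ε > 0 (depending only on ε, a, α, n and U) such that for all measurable functions f, z : U → ℝ with ∫_U |f|^b dx < ∞ and ∫_U |z|^α dx < ∞, ∫_U |f|^{2−a}·|z|^{α−2} dx ≤ ε·(∫_U |z|^α dx)^{1/γ₀} + C_ε·(∫_U |f|^b dx)^{(α−a)/b}. -/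
open Set MeasureTheory

/-- Young's inequality with a small parameter. -/
theorem Real.young_inequality_with_eps {p q x y ε : ℝ} (hpq : p.HolderConjugate q)
    (hx : 0 ≤ x) (hy : 0 ≤ y) (hε : 0 < ε) :
    x * y ≤ ε * x ^ p + ε ^ (-(q / p)) * y ^ q := by
  have hp := hpq.pos
  have hq := hpq.symm.pos
  have key := Real.young_inequality_of_nonneg (mul_nonneg (Real.rpow_nonneg hε.le (1 / p)) hx)
    (mul_nonneg (Real.rpow_nonneg hε.le (-(1 / p))) hy) hpq
  have hxy : ε ^ (1 / p) * x * (ε ^ (-(1 / p)) * y) = x * y := by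
    rw [mul_mul_mul_comm, ← Real.rpow_add hε, add_neg_cancel, Real.rpow_zero, one_mul]
  have hxp : (ε ^ (1 / p) * x) ^ p = ε * x ^ p := by
    rw [Real.mul_rpow (by positivity) hx, ← Real.rpow_mul hε.le, one_div_mul_cancel hp.ne',
      Real.rpow_one]
  have hyq : (ε ^ (-(1 / p)) * y) ^ q = ε ^ (-(q / p)) * y ^ q := by
    rw [Real.mul_rpow (by positivity) hy, ← Real.rpow_mul hε.le]
    congr 2
    ring
  rw [hxy, hxp, hyq] at key
  exact key.trans (add_le_add (div_le_self (by positivity) hpq.lt.le)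
    (div_le_self (by positivity) hpq.symm.lt.le))

/-- Hölder's inequality for a product of powers of two functions. -/
theorem MeasureTheory.integral_rpow_mul_rpow_le {Ω : Type*} [MeasurableSpace Ω] {μ : Measure Ω}
    {p q r s : ℝ} (hpq : p.HolderConjugate q) {f g : Ω → ℝ} (hf : Measurable f)
    (hg : Measurable g) (hfi : Integrable (fun x => |f x| ^ (r * p)) μ)
    (hgi : Integrable (fun x => |g x| ^ (s * q)) μ) :
    ∫ x, |f x| ^ r * |g x| ^ s ∂μ ≤
      (∫ x, |f x| ^ (r * p) ∂μ) ^ (1 / p) * (∫ x, |g x| ^ (s * q) ∂μ) ^ (1 / q) := by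
  have memLp : ∀ {h : Ω → ℝ} {t u : ℝ}, Measurable h → 0 < u →
      Integrable (fun x => |h x| ^ (t * u)) μ →
      MemLp (fun x => |h x| ^ t) (ENNReal.ofReal u) μ := by
    intro h t u hh hu hi
    have hm : Measurable fun x => |h x| ^ t := by
      simpa only [Real.norm_eq_abs] using hh.norm.pow_const t
    rw [← integrable_norm_rpow_iff hm.aestronglyMeasurable (by simpa using hu) (by simp)]
    refine hi.congr (.of_forall fun x => ?_)
    simp only [ENNReal.toReal_ofReal hu.le, Real.norm_eq_abs,
      abs_of_nonneg (Real.rpow_nonneg (abs_nonneg (h x)) t), Real.rpow_mul (abs_nonneg (h x))]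
  have key := integral_mul_le_Lp_mul_Lq_of_nonneg hpq
    (.of_forall fun x => Real.rpow_nonneg (abs_nonneg (f x)) r)
    (.of_forall fun x => Real.rpow_nonneg (abs_nonneg (g x)) s)
    (memLp hf hpq.pos hfi) (memLp hg hpq.symm.pos hgi)
  simpa only [← Real.rpow_mul (abs_nonneg _)] using key

/-- For a bounded measurable `U ⊆ ℝⁿ`, `a ∈ (0,1)`, `α > 2` with
`α ≥ n·a/(2-a)`, `b = α(2-a)/2`, `γ₀ = α/(α-a)`, and any `ε > 0`, there is
`C_ε > 0` such that for all measurable `f, z` with `|f|^b, |z|^α ∈ L¹(U)`,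
`∫_U |f|^{2-a}|z|^{α-2} dx ≤ ε (∫_U |z|^α dx)^{1/γ₀}
  + C_ε (∫_U |f|^b dx)^{(α-a)/b}`. -/
theorem stmt_12
    (n : ℕ) (U : Set (EuclideanSpace ℝ (Fin n)))
    (hUm : MeasurableSet U) (hUb : Bornology.IsBounded U)
    (aa : ℝ) (haa : aa ∈ Ioo (0:ℝ) 1)
    (αe : ℝ) (hαe2 : 2 < αe) (hαen : (n : ℝ) * aa / (2 - aa) ≤ αe)
    (b γ₀ : ℝ) (hb : b = αe * (2 - aa) / 2) (hγ₀ : γ₀ = αe / (αe - aa))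
    (ε : ℝ) (hε : 0 < ε) :
    ∃ Cε : ℝ, 0 < Cε ∧
      ∀ f z : EuclideanSpace ℝ (Fin n) → ℝ, Measurable f → Measurable z →
        IntegrableOn (fun x => |f x| ^ b) U →
        IntegrableOn (fun x => |z x| ^ αe) U →
        (∫ x in U, |f x| ^ (2 - aa) * |z x| ^ (αe - 2)) ≤
          ε * (∫ x in U, |z x| ^ αe) ^ (1 / γ₀) +
            Cε * (∫ x in U, |f x| ^ b) ^ ((αe - aa) / b) := by
  obtain ⟨ha0, ha1⟩ := haa
  have h2a : 0 < 2 - aa := by linarith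
  have hα2 : 0 < αe - 2 := by linarith
  have hαa : 0 < αe - aa := by linarith
  have hα : 0 < αe := by linarith
  have hHolder : (αe / 2).HolderConjugate (αe / (αe - 2)) := by
    rw [Real.holderConjugate_iff]
    refine ⟨by linarith, ?_⟩
    field_simp
    ring
  have hYoung : ((αe - aa) / (αe - 2)).HolderConjugate ((αe - aa) / (2 - aa)) := by
    rw [Real.holderConjugate_iff]
    refine ⟨by rw [one_lt_div hα2]; linarith, ?_⟩
    field_simp
    ring
  refine ⟨ε ^ (-(((αe - aa) / (2 - aa)) / ((αe - aa) / (αe - 2)))), Real.rpow_pos_of_pos hε _,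
    fun f z hf hz hfi hzi => ?_⟩
  have hbp : (2 - aa) * (αe / 2) = b := by rw [hb]; ring
  have hαq : (αe - 2) * (αe / (αe - 2)) = αe := by field_simp
  have hint := integral_rpow_mul_rpow_le (μ := volume.restrict U) (r := 2 - aa) (s := αe - 2)
    hHolder hf hz (by rw [hbp]; exact hfi) (by rw [hαq]; exact hzi)
  rw [hbp, hαq, mul_comm (_ ^ _)] at hint
  have hF : 0 ≤ ∫ x in U, |f x| ^ b := integral_nonneg fun x => by positivity
  have hZ : 0 ≤ ∫ x in U, |z x| ^ αe := integral_nonneg fun x => by positivity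
  refine hint.trans ((Real.young_inequality_with_eps hYoung (Real.rpow_nonneg hZ _)
    (Real.rpow_nonneg hF _) hε).trans_eq ?_)
  rw [← Real.rpow_mul hZ, ← Real.rpow_mul hF]
  have hγ : 1 / (αe / (αe - 2)) * ((αe - aa) / (αe - 2)) = 1 / γ₀ := by
    rw [hγ₀]
    field_simp
  have hFexp : 1 / (αe / 2) * ((αe - aa) / (2 - aa)) = (αe - aa) / b := by
    rw [hb]
    field_simp
  rw [hγ, hFexp]
end

section
/- Let U ⊂ ℝⁿ be a bounded measurable set, let a ∈ (0,1), let α > 2 with α ≥ n·a/(2−a), and set γ₀ = α/(α−a). Then for every ε > 0 there exists a constant C_ε > 0 (depending only on ε, a, α, n and U) such that for all measurable functions h, z : U → ℝ with ∫_U |h|^α dx < ∞ and ∫_U |z|^α dx < ∞, ∫_U |h|·|z|^{α−1} dx ≤ ε·(∫_U |z|^α dx)^{1/γ₀} + C_ε·(∫_U |h|^α dx)^{(α−a)/(α(1−a))}. -/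
open Set MeasureTheory

/-- Hölder's inequality for `∫ |h| |z|^(p-1)`, with both factors measured in `L^p`. -/
theorem integral_abs_mul_rpow_sub_one_le {X : Type*} [MeasurableSpace X] {μ : Measure X}
    {p : ℝ} (hp : 1 < p) {h z : X → ℝ} (hh : Measurable h) (hz : Measurable z)
    (hhi : Integrable (fun x => |h x| ^ p) μ) (hzi : Integrable (fun x => |z x| ^ p) μ) :
    ∫ x, |h x| * |z x| ^ (p - 1) ∂μ ≤
      (∫ x, |h x| ^ p ∂μ) ^ (1 / p) * (∫ x, |z x| ^ p ∂μ) ^ ((p - 1) / p) := by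
  have hp0 : 0 < p := by linarith
  have hp1 : 0 < p - 1 := by linarith
  have hpq : p.HolderConjugate (p / (p - 1)) := Real.HolderConjugate.conjExponent hp
  have hq0 : 0 < p / (p - 1) := by positivity
  have hpow (x : X) : (|z x| ^ (p - 1)) ^ (p / (p - 1)) = |z x| ^ p := by
    rw [← Real.rpow_mul (abs_nonneg _), mul_div_cancel₀ _ hp1.ne']
  have hhL : MemLp (fun x => |h x|) (ENNReal.ofReal p) μ := by
    rw [← integrable_norm_rpow_iff hh.abs.aestronglyMeasurable (by simpa using hp0) (by simp)]
    simpa [ENNReal.toReal_ofReal hp0.le] using hhi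
  have hzL : MemLp (fun x => |z x| ^ (p - 1)) (ENNReal.ofReal (p / (p - 1))) μ := by
    rw [← integrable_norm_rpow_iff (hz.abs.pow_const _).aestronglyMeasurable
      (by simpa using hq0) (by simp)]
    simpa [ENNReal.toReal_ofReal hq0.le, abs_of_nonneg, Real.rpow_nonneg, hpow] using hzi
  have key := integral_mul_le_Lp_mul_Lq_of_nonneg hpq
    (Filter.Eventually.of_forall fun x => abs_nonneg (h x))
    (Filter.Eventually.of_forall fun x => Real.rpow_nonneg (abs_nonneg (z x)) (p - 1)) hhL hzL
  simpa only [hpow, one_div_div] using key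

/-- Young's inequality with a small parameter in front of one of the two terms. -/
theorem Real.exists_mul_le_mul_rpow_add_mul_rpow {p q : ℝ} (hpq : p.HolderConjugate q)
    {ε : ℝ} (hε : 0 < ε) :
    ∃ C : ℝ, 0 < C ∧ ∀ a b : ℝ, 0 ≤ a → 0 ≤ b → a * b ≤ ε * b ^ p + C * a ^ q := by
  set δ : ℝ := ε ^ (1 / p)
  have hδ : 0 < δ := Real.rpow_pos_of_pos hε _
  have hδp : δ ^ p = ε := by
    rw [← Real.rpow_mul hε.le, one_div_mul_cancel hpq.ne_zero, Real.rpow_one]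
  refine ⟨δ⁻¹ ^ q, by positivity, fun a b ha hb => ?_⟩
  calc a * b = (δ * b) * (δ⁻¹ * a) := by field_simp
    _ ≤ (δ * b) ^ p / p + (δ⁻¹ * a) ^ q / q :=
      Real.young_inequality_of_nonneg (by positivity) (by positivity) hpq
    _ ≤ (δ * b) ^ p + (δ⁻¹ * a) ^ q :=
      add_le_add (div_le_self (by positivity) hpq.lt.le)
        (div_le_self (by positivity) hpq.symm.lt.le)
    _ = ε * b ^ p + δ⁻¹ ^ q * a ^ q := by
      rw [Real.mul_rpow hδ.le hb, Real.mul_rpow (by positivity) ha, hδp]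

/-- For a bounded measurable `U ⊆ ℝⁿ`, `a ∈ (0,1)`, `α > 2` with
`α ≥ n·a/(2-a)` and `γ₀ = α/(α-a)`, and any `ε > 0`, there is `C_ε > 0` such
that for all measurable `h, z` with `|h|^α, |z|^α ∈ L¹(U)`,
`∫_U |h||z|^{α-1} dx ≤ ε (∫_U |z|^α dx)^{1/γ₀}
  + C_ε (∫_U |h|^α dx)^{(α-a)/(α(1-a))}`. -/
theorem stmt_13
    (n : ℕ) (U : Set (EuclideanSpace ℝ (Fin n)))
    (hUm : MeasurableSet U) (hUb : Bornology.IsBounded U)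
    (aa : ℝ) (haa : aa ∈ Ioo (0:ℝ) 1)
    (αe : ℝ) (hαe2 : 2 < αe) (hαen : (n : ℝ) * aa / (2 - aa) ≤ αe)
    (γ₀ : ℝ) (hγ₀ : γ₀ = αe / (αe - aa))
    (ε : ℝ) (hε : 0 < ε) :
    ∃ Cε : ℝ, 0 < Cε ∧
      ∀ h z : EuclideanSpace ℝ (Fin n) → ℝ, Measurable h → Measurable z →
        IntegrableOn (fun x => |h x| ^ αe) U →
        IntegrableOn (fun x => |z x| ^ αe) U →
        (∫ x in U, |h x| * |z x| ^ (αe - 1)) ≤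
          ε * (∫ x in U, |z x| ^ αe) ^ (1 / γ₀) +
            Cε * (∫ x in U, |h x| ^ αe) ^ ((αe - aa) / (αe * (1 - aa))) := by
  obtain ⟨ha0, ha1⟩ := haa
  have hα0 : 0 < αe := by linarith
  have hα1 : 0 < αe - 1 := by linarith
  have hαa : 0 < αe - aa := by linarith
  have h1a : 0 < 1 - aa := by linarith
  have hpq : ((αe - aa) / (αe - 1)).HolderConjugate ((αe - aa) / (1 - aa)) := by
    rw [Real.holderConjugate_iff]
    refine ⟨(one_lt_div hα1).2 (by linarith), ?_⟩
    field_simp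
    ring
  obtain ⟨C, hC, hyoung⟩ := Real.exists_mul_le_mul_rpow_add_mul_rpow hpq hε
  refine ⟨C, hC, fun h z hh hz hhi hzi => ?_⟩
  have hH : 0 ≤ ∫ x in U, |h x| ^ αe := integral_nonneg fun x => by positivity
  have hZ : 0 ≤ ∫ x in U, |z x| ^ αe := integral_nonneg fun x => by positivity
  have hyoungHZ :=
    hyoung _ _ (Real.rpow_nonneg hH (1 / αe)) (Real.rpow_nonneg hZ ((αe - 1) / αe))
  have hexpZ : (αe - 1) / αe * ((αe - aa) / (αe - 1)) = 1 / γ₀ := by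
    rw [hγ₀]
    field_simp
  have hexpH : 1 / αe * ((αe - aa) / (1 - aa)) = (αe - aa) / (αe * (1 - aa)) := by
    field_simp
  rw [← Real.rpow_mul hZ, ← Real.rpow_mul hH, hexpZ, hexpH] at hyoungHZ
  exact (integral_abs_mul_rpow_sub_one_le (by linarith) hh hz hhi hzi).trans hyoungHZ
end
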